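/- arXiv:1602.00473 — 4 statements merged into one kernel-verified Lean document; each statement's English description precedes it below -/
import Mathlib

section
/- Let X be a Banach space. A multifunction Γ : [0,1] → cwk(X) is variationally McShane integrable if and only if it is variationally Henstock integrable and integrably bounded. -/
open Set Metric MeasureTheory Pointwise
open scoped ENNReal NNReal

namespace GaugePaper

variable (X : Type*) [NormedAddCommGroup X] [NormedSpace ℝ X]

/-- `A ∈ cwk(X)`: `A` is a nonempty, convex and weakly compact subset of `X`. -/
def IsCWK (A : Set X) : Prop :=
  A.Nonempty ∧ Convex ℝ A ∧ IsCompact (toWeakSpace ℝ X '' A)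

variable {X}

/-- The support function `σ(x*, A)`. -/
noncomputable def suppFn (x' : X →L[ℝ] ℝ) (A : Set X) : ℝ := sSup (x' '' A)

/-- `‖A‖ = sup {‖x‖ : x ∈ A}`. -/
noncomputable def setNorm (A : Set X) : ℝ := sSup ((fun x => ‖x‖) '' A)

/-- A gauge on `[0,1]`: a positive function. -/
def IsGauge (δ : ℝ → ℝ) : Prop := ∀ t ∈ Icc (0:ℝ) 1, 0 < δ t

/-- A tagged partition of `[0,1]` into `n` (possibly degenerate) nonoverlapping closed
subintervals `[pt i, pt (i+1)]`, with tags `tag i ∈ [0,1]`. -/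
structure TP (n : ℕ) where
  pt : Fin (n + 1) → ℝ
  tag : Fin n → ℝ
  mono : Monotone pt
  first : pt 0 = 0
  last : pt (Fin.last n) = 1
  tagMem : ∀ i, tag i ∈ Icc (0:ℝ) 1

namespace TP

variable {n : ℕ} (P : TP n)

/-- The `i`-th subinterval of the partition. -/
def ivl (i : Fin n) : Set ℝ := Icc (P.pt i.castSucc) (P.pt i.succ)

/-- The length `|I_i|` of the `i`-th subinterval. -/
def len (i : Fin n) : ℝ := P.pt i.succ - P.pt i.castSucc

/-- A Perron (Henstock) partition: each tag belongs to its interval. -/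
def IsPerron : Prop := ∀ i, P.tag i ∈ P.ivl i

/-- `δ`-fineness: `I_i ⊆ (t_i - δ(t_i), t_i + δ(t_i))`. -/
def IsFine (δ : ℝ → ℝ) : Prop :=
  ∀ i, P.ivl i ⊆ Ioo (P.tag i - δ (P.tag i)) (P.tag i + δ (P.tag i))

/-- An interior Henstock partition: each tag is in the interior of its interval, except
possibly for intervals containing `0` or `1`, where the tag may also be `0` or `1`. -/
def IsInterior : Prop :=
  ∀ i, P.tag i ∈ Ioo (P.pt i.castSucc) (P.pt i.succ) ∨
    (((0:ℝ) ∈ P.ivl i ∨ (1:ℝ) ∈ P.ivl i) ∧ P.tag i ∈ P.ivl i ∩ ({0, 1} : Set ℝ))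

end TP

/-- Riemann sum of a multifunction: `∑ i |I_i| • Γ(t_i)` (Minkowski sums). -/
def mSum {n : ℕ} (P : TP n) (Γ : ℝ → Set X) : Set X :=
  ∑ i : Fin n, P.len i • Γ (P.tag i)

/-- Riemann sum of a function: `∑ i |I_i| • f(t_i)`. -/
def fSum {n : ℕ} (P : TP n) (f : ℝ → X) : X :=
  ∑ i : Fin n, P.len i • f (P.tag i)

/-! ### Gauge integrals of multifunctions -/

/-- Henstock integrability of a multifunction `Γ : [0,1] → cwk(X)`. -/
def HenstockIntegrable (Γ : ℝ → Set X) : Prop :=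
  ∃ I : Set X, IsCWK X I ∧ ∀ ε > 0, ∃ δ : ℝ → ℝ, IsGauge δ ∧
    ∀ (n : ℕ) (P : TP n), P.IsPerron → P.IsFine δ → hausdorffDist I (mSum P Γ) < ε

/-- McShane integrability of a multifunction (free tags). -/
def McShaneIntegrable (Γ : ℝ → Set X) : Prop :=
  ∃ I : Set X, IsCWK X I ∧ ∀ ε > 0, ∃ δ : ℝ → ℝ, IsGauge δ ∧
    ∀ (n : ℕ) (P : TP n), P.IsFine δ → hausdorffDist I (mSum P Γ) < ε

/-- `ℋ`-integrability: Henstock integrability with Lebesgue measurable gauges. -/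
def HMeasIntegrable (Γ : ℝ → Set X) : Prop :=
  ∃ I : Set X, IsCWK X I ∧ ∀ ε > 0, ∃ δ : ℝ → ℝ, IsGauge δ ∧ AEMeasurable δ volume ∧
    ∀ (n : ℕ) (P : TP n), P.IsPerron → P.IsFine δ → hausdorffDist I (mSum P Γ) < ε

/-- Birkhoff (`ℳ`-) integrability: McShane integrability with Lebesgue measurable gauges. -/
def BirkhoffIntegrable (Γ : ℝ → Set X) : Prop :=
  ∃ I : Set X, IsCWK X I ∧ ∀ ε > 0, ∃ δ : ℝ → ℝ, IsGauge δ ∧ AEMeasurable δ volume ∧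
    ∀ (n : ℕ) (P : TP n), P.IsFine δ → hausdorffDist I (mSum P Γ) < ε

/-! ### Gauge integrals of (single-valued) functions -/

/-- Henstock integrability of a function `f : [0,1] → X`. -/
def FHenstockIntegrable (f : ℝ → X) : Prop :=
  ∃ w : X, ∀ ε > 0, ∃ δ : ℝ → ℝ, IsGauge δ ∧
    ∀ (n : ℕ) (P : TP n), P.IsPerron → P.IsFine δ → ‖w - fSum P f‖ < ε

/-- McShane integrability of a function. -/
def FMcShaneIntegrable (f : ℝ → X) : Prop :=
  ∃ w : X, ∀ ε > 0, ∃ δ : ℝ → ℝ, IsGauge δ ∧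
    ∀ (n : ℕ) (P : TP n), P.IsFine δ → ‖w - fSum P f‖ < ε

/-- `ℋ`-integrability of a function: measurable gauges. -/
def FHMeasIntegrable (f : ℝ → X) : Prop :=
  ∃ w : X, ∀ ε > 0, ∃ δ : ℝ → ℝ, IsGauge δ ∧ AEMeasurable δ volume ∧
    ∀ (n : ℕ) (P : TP n), P.IsPerron → P.IsFine δ → ‖w - fSum P f‖ < ε

/-- Birkhoff (`ℳ`-) integrability of a function: McShane with measurable gauges. -/
def FBirkhoffIntegrable (f : ℝ → X) : Prop :=
  ∃ w : X, ∀ ε > 0, ∃ δ : ℝ → ℝ, IsGauge δ ∧ AEMeasurable δ volume ∧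
    ∀ (n : ℕ) (P : TP n), P.IsFine δ → ‖w - fSum P f‖ < ε

/-- Henstock–Kurzweil integrability of a real-valued function on `[0,1]`. -/
def HKIntegrable (g : ℝ → ℝ) : Prop :=
  ∃ A : ℝ, ∀ ε > 0, ∃ δ : ℝ → ℝ, IsGauge δ ∧
    ∀ (n : ℕ) (P : TP n), P.IsPerron → P.IsFine δ → |fSum P g - A| < ε

/-! ### Pettis integrals -/

/-- Pettis integrability of a function `f : [0,1] → X`. -/
def FPettisIntegrable (f : ℝ → X) : Prop :=
  (∀ x' : X →L[ℝ] ℝ, IntegrableOn (fun t => x' (f t)) (Icc (0:ℝ) 1) volume) ∧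
  ∀ E ⊆ Icc (0:ℝ) 1, NullMeasurableSet E volume →
    ∃ ν : X, ∀ x' : X →L[ℝ] ℝ, x' ν = ∫ t in E, x' (f t)

/-- Pettis integrability of a multifunction `Γ : [0,1] → cwk(X)`. -/
def PettisIntegrable (Γ : ℝ → Set X) : Prop :=
  (∀ x' : X →L[ℝ] ℝ, IntegrableOn (fun t => suppFn x' (Γ t)) (Icc (0:ℝ) 1) volume) ∧
  ∀ E ⊆ Icc (0:ℝ) 1, NullMeasurableSet E volume →
    ∃ W : Set X, IsCWK X W ∧ ∀ x' : X →L[ℝ] ℝ, suppFn x' W = ∫ t in E, suppFn x' (Γ t)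

/-- `f` is a selection of `Γ`. -/
def Selection (Γ : ℝ → Set X) (f : ℝ → X) : Prop := ∀ t ∈ Icc (0:ℝ) 1, f t ∈ Γ t

/-! ### Variational integrals -/

/-- Finite additivity of an interval multifunction on subintervals of `[0,1]`
(an interval `[a,b] ⊆ [0,1]` is encoded by its endpoints). -/
def AdditiveIntervalMF (Φ : ℝ → ℝ → Set X) : Prop :=
  ∀ a b c : ℝ, 0 ≤ a → a ≤ b → b ≤ c → c ≤ 1 → Φ a c = Φ a b + Φ b c

/-- Finite additivity of a vector-valued interval function on subintervals of `[0,1]`. -/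
def AdditiveIntervalF (Φ : ℝ → ℝ → X) : Prop :=
  ∀ a b c : ℝ, 0 ≤ a → a ≤ b → b ≤ c → c ≤ 1 → Φ a c = Φ a b + Φ b c

/-- `Φ` is a variational Henstock primitive of the multifunction `Γ`. -/
def vHPrimitive (Γ : ℝ → Set X) (Φ : ℝ → ℝ → Set X) : Prop :=
  (∀ a b : ℝ, 0 ≤ a → a ≤ b → b ≤ 1 → IsCWK X (Φ a b)) ∧ AdditiveIntervalMF Φ ∧
  ∀ ε > 0, ∃ δ : ℝ → ℝ, IsGauge δ ∧ ∀ (n : ℕ) (P : TP n), P.IsPerron → P.IsFine δ →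
    ∑ i : Fin n, hausdorffDist (Φ (P.pt i.castSucc) (P.pt i.succ)) (P.len i • Γ (P.tag i)) < ε

/-- Variational Henstock integrability of a multifunction. -/
def vHIntegrable (Γ : ℝ → Set X) : Prop := ∃ Φ : ℝ → ℝ → Set X, vHPrimitive Γ Φ

/-- Variational McShane integrability of a multifunction (free tags). -/
def vMSIntegrable (Γ : ℝ → Set X) : Prop :=
  ∃ Φ : ℝ → ℝ → Set X,
    (∀ a b : ℝ, 0 ≤ a → a ≤ b → b ≤ 1 → IsCWK X (Φ a b)) ∧ AdditiveIntervalMF Φ ∧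
    ∀ ε > 0, ∃ δ : ℝ → ℝ, IsGauge δ ∧ ∀ (n : ℕ) (P : TP n), P.IsFine δ →
      ∑ i : Fin n, hausdorffDist (Φ (P.pt i.castSucc) (P.pt i.succ)) (P.len i • Γ (P.tag i)) < ε

/-- Variational `ℋ`-integrability of a multifunction: measurable gauges. -/
def vHMeasIntegrable (Γ : ℝ → Set X) : Prop :=
  ∃ Φ : ℝ → ℝ → Set X,
    (∀ a b : ℝ, 0 ≤ a → a ≤ b → b ≤ 1 → IsCWK X (Φ a b)) ∧ AdditiveIntervalMF Φ ∧
    ∀ ε > 0, ∃ δ : ℝ → ℝ, IsGauge δ ∧ AEMeasurable δ volume ∧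
      ∀ (n : ℕ) (P : TP n), P.IsPerron → P.IsFine δ →
        ∑ i : Fin n, hausdorffDist (Φ (P.pt i.castSucc) (P.pt i.succ)) (P.len i • Γ (P.tag i)) < ε

/-- `Φ` is a variational Henstock primitive of the function `f`. -/
def FvHPrimitive (f : ℝ → X) (Φ : ℝ → ℝ → X) : Prop :=
  AdditiveIntervalF Φ ∧
  ∀ ε > 0, ∃ δ : ℝ → ℝ, IsGauge δ ∧ ∀ (n : ℕ) (P : TP n), P.IsPerron → P.IsFine δ →
    ∑ i : Fin n, ‖Φ (P.pt i.castSucc) (P.pt i.succ) - P.len i • f (P.tag i)‖ < ε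

/-- Variational Henstock integrability of a function. -/
def FvHIntegrable (f : ℝ → X) : Prop := ∃ Φ : ℝ → ℝ → X, FvHPrimitive f Φ

/-- Variational McShane integrability of a function (free tags). -/
def FvMSIntegrable (f : ℝ → X) : Prop :=
  ∃ Φ : ℝ → ℝ → X, AdditiveIntervalF Φ ∧
    ∀ ε > 0, ∃ δ : ℝ → ℝ, IsGauge δ ∧ ∀ (n : ℕ) (P : TP n), P.IsFine δ →
      ∑ i : Fin n, ‖Φ (P.pt i.castSucc) (P.pt i.succ) - P.len i • f (P.tag i)‖ < ε

/-- Variational `ℋ`-integrability of a function: measurable gauges. -/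
def FvHMeasIntegrable (f : ℝ → X) : Prop :=
  ∃ Φ : ℝ → ℝ → X, AdditiveIntervalF Φ ∧
    ∀ ε > 0, ∃ δ : ℝ → ℝ, IsGauge δ ∧ AEMeasurable δ volume ∧
      ∀ (n : ℕ) (P : TP n), P.IsPerron → P.IsFine δ →
        ∑ i : Fin n, ‖Φ (P.pt i.castSucc) (P.pt i.succ) - P.len i • f (P.tag i)‖ < ε

/-! ### Partial Perron partitions and variational measures -/

/-- A finite tagged Perron family of `n` nonoverlapping closed subintervals
`[a i, b i]` of `[0,1]` (a "partition in `[0,1]`", not necessarily covering it). -/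
structure PTP (n : ℕ) where
  a : Fin n → ℝ
  b : Fin n → ℝ
  tag : Fin n → ℝ
  le : ∀ i, a i ≤ b i
  sub : ∀ i, Icc (a i) (b i) ⊆ Icc (0:ℝ) 1
  nonoverlap : ∀ i j, i ≠ j → (Icc (a i) (b i) ∩ Icc (a j) (b j)).Subsingleton
  perron : ∀ i, tag i ∈ Icc (a i) (b i)

/-- `δ`-fineness of a partial Perron family. -/
def PTP.IsFine {n : ℕ} (P : PTP n) (δ : ℝ → ℝ) : Prop :=
  ∀ i, Icc (P.a i) (P.b i) ⊆ Ioo (P.tag i - δ (P.tag i)) (P.tag i + δ (P.tag i))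

/-- `Var(Ψ, δ, E)` for a scalar interval function `Ψ`. -/
noncomputable def scVar (Ψ : ℝ → ℝ → ℝ) (δ : ℝ → ℝ) (E : Set ℝ) : ℝ≥0∞ :=
  ⨆ (n : ℕ) (P : PTP n) (_ : P.IsFine δ ∧ ∀ i, P.tag i ∈ E),
    ∑ i : Fin n, ENNReal.ofReal |Ψ (P.a i) (P.b i)|

/-- The variational measure `V_Ψ(E)` generated by a scalar interval function `Ψ`. -/
noncomputable def scVarMeasure (Ψ : ℝ → ℝ → ℝ) (E : Set ℝ) : ℝ≥0∞ :=
  ⨅ (δ : ℝ → ℝ) (_ : IsGauge δ), scVar Ψ δ E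

/-! ### Tagged chains of intervals and monotone majorants -/

/-- `TaggedChain R w a b s`: the interval `[a, b]` can be cut into consecutive tagged intervals
satisfying `R`, with total weight `s` with respect to `w`. -/
inductive TaggedChain (R : ℝ → ℝ → ℝ → Prop) (w : ℝ → ℝ → ℝ → ℝ) : ℝ → ℝ → ℝ → Prop
  | nil (a : ℝ) : TaggedChain R w a a 0
  | cons {a b c t s : ℝ} : a ≤ b → R a b t → TaggedChain R w b c s →
      TaggedChain R w a c (w a b t + s)

namespace TaggedChain

variable {R : ℝ → ℝ → ℝ → Prop} {w : ℝ → ℝ → ℝ → ℝ} {a b c s s' t : ℝ}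

theorem single (hab : a ≤ b) (h : R a b t) : TaggedChain R w a b (w a b t) := by
  simpa using TaggedChain.cons (w := w) hab h (.nil b)

theorem append (h : TaggedChain R w a b s) (h' : TaggedChain R w b c s') :
    TaggedChain R w a c (s + s') := by
  induction h with
  | nil a => simpa using h'
  | cons hab hR _ ih => rw [add_assoc]; exact .cons hab hR (ih h')

theorem nonneg (hw : ∀ u v t, u ≤ v → 0 ≤ w u v t) (h : TaggedChain R w a b s) : 0 ≤ s := by
  induction h with
  | nil a => exact le_rfl
  | cons hab _ _ ih => exact add_nonneg (hw _ _ _ hab) ih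

theorem exists_points (h : TaggedChain R w a b s) :
    ∃ (n : ℕ) (pt : Fin (n + 1) → ℝ) (tag : Fin n → ℝ), Monotone pt ∧ pt 0 = a ∧
      pt (Fin.last n) = b ∧ (∀ i : Fin n, R (pt i.castSucc) (pt i.succ) (tag i)) ∧
      ∑ i : Fin n, w (pt i.castSucc) (pt i.succ) (tag i) = s := by
  induction h with
  | nil a => exact ⟨0, fun _ => a, Fin.elim0, monotone_const, rfl, rfl, fun i => i.elim0, by simp⟩
  | @cons a b c t s hab hR _ ih =>
    obtain ⟨n, pt, tag, hm, h0, hl, hRs, hsum⟩ := ih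
    refine ⟨n + 1, Fin.cons a pt, Fin.cons t tag, ?_, rfl, ?_, ?_, ?_⟩
    · rw [Fin.monotone_iff_le_succ]
      intro i
      refine Fin.cases ?_ (fun j => ?_) i
      · simpa [h0] using hab
      · simpa using hm (Fin.castSucc_lt_succ (i := j)).le
    · simpa [← Fin.succ_last] using hl
    · intro i
      refine Fin.cases ?_ (fun j => ?_) i
      · simpa [h0] using hR
      · simpa using hRs j
    · rw [Fin.sum_univ_succ]
      simp [h0, hsum]

end TaggedChain

/-- A tagged interval `([u, v], t)` with tag in `[0,1]` that is `δ`-fine and satisfies the tag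
condition `C`. -/
def Admissible (C : ℝ → ℝ → ℝ → Prop) (δ : ℝ → ℝ) (u v t : ℝ) : Prop :=
  t ∈ Icc (0:ℝ) 1 ∧ C u v t ∧ Icc u v ⊆ Ioo (t - δ t) (t + δ t)

theorem Admissible.mono {C C' : ℝ → ℝ → ℝ → Prop} {δ δ' : ℝ → ℝ} {u v t : ℝ}
    (h : Admissible C δ u v t) (hC : C u v t → C' u v t) (hδ : δ t ≤ δ' t) :
    Admissible C' δ' u v t :=
  ⟨h.1, hC h.2.1, h.2.2.trans (Ioo_subset_Ioo (by linarith) (by linarith))⟩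

/-- **Cousin's lemma**. -/
theorem exists_taggedChain {C : ℝ → ℝ → ℝ → Prop} (hC : ∀ u v t, t ∈ Icc u v → C u v t)
    {δ : ℝ → ℝ} (hδ : IsGauge δ) (w : ℝ → ℝ → ℝ → ℝ) {a b : ℝ} (ha : 0 ≤ a) (hab : a ≤ b)
    (hb : b ≤ 1) : ∃ s, TaggedChain (Admissible C δ) w a b s := by
  set S : Set ℝ := {x | x ∈ Icc a b ∧ ∃ s, TaggedChain (Admissible C δ) w a x s}
  have haS : a ∈ S := ⟨left_mem_Icc.2 hab, 0, .nil a⟩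
  have hbdd : BddAbove S := ⟨b, fun x hx => hx.1.2⟩
  set c := sSup S
  have hac : a ≤ c := le_csSup hbdd haS
  have hcb : c ≤ b := csSup_le ⟨a, haS⟩ fun x hx => hx.1.2
  have hc01 : c ∈ Icc (0:ℝ) 1 := ⟨ha.trans hac, hcb.trans hb⟩
  have hδc := hδ c hc01
  obtain ⟨x, hxS, hx⟩ := exists_lt_of_lt_csSup ⟨a, haS⟩ (show c - δ c < c by linarith)
  obtain ⟨hxab, s, hs⟩ := hxS
  have hxc : x ≤ c := le_csSup hbdd ⟨hxab, s, hs⟩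
  set d := min b (c + δ c / 2)
  have hcd : c ≤ d := le_min hcb (by linarith)
  have hd : d ≤ c + δ c / 2 := min_le_right _ _
  have hchain : TaggedChain (Admissible C δ) w a d (s + w x d c) :=
    hs.append (.single (hxc.trans hcd) ⟨hc01, hC _ _ _ ⟨hxc, hcd⟩,
      fun y hy => ⟨hx.trans_le hy.1, by linarith [hy.2]⟩⟩)
  have hdS : d ∈ S := ⟨⟨hac.trans hcd, min_le_left _ _⟩, _, hchain⟩
  have hdc : d ≤ c := le_csSup hbdd hdS
  have hdb : d = b := by
    rcases min_choice b (c + δ c / 2) with h | h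
    · exact h
    · have : d = c + δ c / 2 := h
      linarith
  exact ⟨_, hdb ▸ hchain⟩

/-- If the sums of a nonnegative weight over all fine tagged partitions are small, then the weight
of each fine tagged interval is dominated by the increment of a monotone function of small total
variation. -/
theorem exists_monotone_majorant {C : ℝ → ℝ → ℝ → Prop} (hC : ∀ u v t, t ∈ Icc u v → C u v t)
    {δ : ℝ → ℝ} (hδ : IsGauge δ) {w : ℝ → ℝ → ℝ → ℝ} (hw : ∀ u v t, u ≤ v → 0 ≤ w u v t) {ε : ℝ}
    (h : ∀ (n : ℕ) (P : TP n), (∀ i : Fin n, C (P.pt i.castSucc) (P.pt i.succ) (P.tag i)) →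
      P.IsFine δ → ∑ i : Fin n, w (P.pt i.castSucc) (P.pt i.succ) (P.tag i) < ε) :
    ∃ V : ℝ → ℝ, Monotone V ∧ V 1 - V 0 ≤ ε ∧ ∀ u v t, 0 ≤ u → u ≤ v → v ≤ 1 →
      Admissible C δ u v t → w u v t ≤ V v - V u := by
  have hbound : ∀ x s, 0 ≤ x → x ≤ 1 → TaggedChain (Admissible C δ) w 0 x s → s ≤ ε := by
    intro x s hx0 hx1 hs
    obtain ⟨s', hs'⟩ := exists_taggedChain hC hδ w hx0 hx1 le_rfl
    obtain ⟨n, pt, tag, hm, h0, hl, hR, hsum⟩ := (hs.append hs').exists_points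
    have := h n ⟨pt, tag, hm, h0, hl, fun i => (hR i).1⟩ (fun i => (hR i).2.1)
      (fun i => (hR i).2.2)
    simp only [hsum] at this
    linarith [hs'.nonneg hw]
  set c : ℝ → ℝ := fun x => max 0 (min 1 x) with hc
  have hc0 : ∀ x, 0 ≤ c x := fun x => le_max_left _ _
  have hc1 : ∀ x, c x ≤ 1 := fun x => max_le zero_le_one (min_le_left _ _)
  have hcm : Monotone c := fun x y hxy => max_le_max le_rfl (min_le_min le_rfl hxy)
  have hcx : ∀ x, 0 ≤ x → x ≤ 1 → c x = x := fun x h0 h1 => by simp [hc, h0, h1]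
  set S : ℝ → Set ℝ := fun x => {s | TaggedChain (Admissible C δ) w 0 (c x) s} with hS
  have hne : ∀ x, (S x).Nonempty := fun x =>
    exists_taggedChain hC hδ w le_rfl (hc0 x) (hc1 x)
  have hbdd : ∀ x, BddAbove (S x) := fun x => ⟨ε, fun s hs => hbound _ s (hc0 x) (hc1 x) hs⟩
  refine ⟨fun x => sSup (S x), fun x y hxy => ?_, ?_, fun u v t hu huv hv hadm => ?_⟩
  · refine csSup_le (hne x) fun s hs => ?_
    obtain ⟨s', hs'⟩ := exists_taggedChain hC hδ w (hc0 x) (hcm hxy) (hc1 y)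
    have := le_csSup (hbdd y) (show s + s' ∈ S y from TaggedChain.append hs hs')
    linarith [hs'.nonneg hw]
  · have h0 : 0 ≤ sSup (S 0) := le_csSup (hbdd 0) (by
      simp only [hS, mem_ofPred_eq, hcx 0 le_rfl zero_le_one]; exact .nil 0)
    have h1 : sSup (S 1) ≤ ε := csSup_le (hne 1) fun s hs => hbound _ s (hc0 1) (hc1 1) hs
    simp only
    linarith
  · have : sSup (S u) ≤ sSup (S v) - w u v t := by
      refine csSup_le (hne u) fun s hs => ?_
      have hs' : TaggedChain (Admissible C δ) w 0 u s := by
        simpa [hS, hcx u hu (huv.trans hv)] using hs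
      have : s + w u v t ∈ S v := by
        simp only [hS, mem_ofPred_eq, hcx v (hu.trans huv) hv]
        exact hs'.append (.single huv hadm)
      linarith [le_csSup (hbdd v) this]
    simp only
    linarith

/-! ### Variational integrability of vector functions via monotone majorants -/

open Filter Topology

section Banach

variable {E : Type*} [NormedAddCommGroup E] [NormedSpace ℝ E]

/-- `G` is a variational primitive of `g` on `[0,1]`, for tags subject to the condition `C`: the
deviation of `g` from `G` over fine tagged intervals is dominated by the increments of monotone
functions of arbitrarily small total variation. -/
def HasMonotoneMajorants (C : ℝ → ℝ → ℝ → Prop) (G g : ℝ → E) : Prop :=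
  ∀ ε > 0, ∃ δ : ℝ → ℝ, IsGauge δ ∧ ∃ V : ℝ → ℝ, Monotone V ∧ V 1 - V 0 ≤ ε ∧
    ∀ u v t, 0 ≤ u → u ≤ v → v ≤ 1 → Admissible C δ u v t →
      ‖G v - G u - (v - u) • g t‖ ≤ V v - V u

/-- The tag condition of Perron partitions. -/
def PerronTag (u v t : ℝ) : Prop := t ∈ Icc u v

/-- The (empty) tag condition of McShane partitions. -/
def FreeTag (_ _ _ : ℝ) : Prop := True

theorem HasMonotoneMajorants.perron {G g : ℝ → E} (h : HasMonotoneMajorants FreeTag G g) :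
    HasMonotoneMajorants PerronTag G g := by
  intro ε hε
  obtain ⟨δ, hδ, V, hV, hVε, H⟩ := h ε hε
  exact ⟨δ, hδ, V, hV, hVε, fun u v t hu huv hv ha =>
    H u v t hu huv hv (ha.mono (fun _ => trivial) le_rfl)⟩

theorem setLIntegral_rnDeriv_stieltjes_le {V : ℝ → ℝ} (hV : Monotone V) :
    ∫⁻ t in Ioo (0:ℝ) 1, hV.stieltjesFunction.measure.rnDeriv volume t ≤
      ENNReal.ofReal (V 1 - V 0) := by
  refine (Measure.setLIntegral_rnDeriv_le _).trans ?_
  rw [StieltjesFunction.measure_Ioo]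
  refine ENNReal.ofReal_le_ofReal (sub_le_sub ?_ (hV.le_rightLim le_rfl))
  refine le_of_tendsto (hV.stieltjesFunction.mono.tendsto_leftLim 1) ?_
  filter_upwards [self_mem_nhdsWithin] with x hx
  exact hV.rightLim_le hx

/-- A function is almost everywhere the derivative of its variational Henstock primitive. -/
theorem HasMonotoneMajorants.ae_hasDerivAt {G g : ℝ → E}
    (h : HasMonotoneMajorants PerronTag G g) :
    ∀ᵐ t ∂(volume.restrict (Ioo (0:ℝ) 1)), HasDerivAt G (g t) t := by
  have hpos : ∀ n : ℕ, (0:ℝ) < (1 / 2) ^ n := fun n => by positivity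
  choose δ hδ V hV hVε H using fun n : ℕ => h _ (hpos n)
  set D : ℕ → ℝ → ℝ≥0∞ := fun n => (hV n).stieltjesFunction.measure.rnDeriv volume with hD
  have hsum : ∀ᵐ t ∂(volume.restrict (Ioo (0:ℝ) 1)), ∑' n, D n t < ∞ := by
    refine ae_lt_top' (AEMeasurable.tsum fun n =>
      (Measure.measurable_rnDeriv _ _).aemeasurable) ?_
    rw [lintegral_tsum fun n => (Measure.measurable_rnDeriv _ _).aemeasurable]
    refine ne_top_of_le_ne_top ?_ (ENNReal.tsum_le_tsum fun n =>
      (setLIntegral_rnDeriv_stieltjes_le (hV n)).trans (ENNReal.ofReal_le_ofReal (hVε n)))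
    rw [← ENNReal.ofReal_tsum_of_nonneg (fun n => (hpos n).le)
      (summable_geometric_of_lt_one (by norm_num) (by norm_num))]
    exact ENNReal.ofReal_ne_top
  have hder : ∀ᵐ t ∂(volume.restrict (Ioo (0:ℝ) 1)), ∀ n, HasDerivAt (V n) (D n t).toReal t :=
    ae_restrict_of_ae (ae_all_iff.2 fun n => (hV n).ae_hasDerivAt)
  filter_upwards [hsum, hder, ae_restrict_mem measurableSet_Ioo] with t hts htd ht
  rw [hasDerivAt_iff_isLittleO, Asymptotics.isLittleO_iff]
  intro c hc
  have hlim : Tendsto (fun n => D n t) atTop (𝓝 0) :=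
    ENNReal.tendsto_atTop_zero_of_tsum_ne_top hts.ne
  obtain ⟨n, hn⟩ := (hlim.eventually_lt_const
    (show (0 : ℝ≥0∞) < ENNReal.ofReal (c / 2) by simpa using hc)).exists
  have hn' : (D n t).toReal < c / 2 := by
    rw [← ENNReal.toReal_ofReal (half_pos hc).le]
    exact (ENNReal.toReal_lt_toReal hn.ne_top ENNReal.ofReal_ne_top).2 hn
  have hVt := (Asymptotics.isLittleO_iff.1 (hasDerivAt_iff_isLittleO.1 (htd n))) (half_pos hc)
  have ht01 : t ∈ Icc (0:ℝ) 1 := Ioo_subset_Icc_self ht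
  have hδt := hδ n t ht01
  have hnear : ∀ᶠ x in 𝓝 t, x ∈ Ioo (t - δ n t) (t + δ n t) :=
    Ioo_mem_nhds (by linarith) (by linarith)
  filter_upwards [hVt, hnear, Ioo_mem_nhds ht.1 ht.2] with x hx hxδ hx01
  have hVx : |V n x - V n t| ≤ c * |x - t| := by
    have h1 : |V n x - V n t| ≤ |V n x - V n t - (x - t) * (D n t).toReal| +
        |(x - t) * (D n t).toReal| := by
      simpa using abs_add_le (V n x - V n t - (x - t) * (D n t).toReal) ((x - t) * (D n t).toReal)
    rw [abs_mul, abs_of_nonneg (ENNReal.toReal_nonneg (a := D n t))] at h1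
    have h2 : |x - t| * (D n t).toReal ≤ |x - t| * (c / 2) :=
      mul_le_mul_of_nonneg_left hn'.le (abs_nonneg _)
    simp only [Real.norm_eq_abs, smul_eq_mul] at hx
    linarith
  rw [Real.norm_eq_abs]
  refine le_trans ?_ hVx
  rcases le_total t x with htx | hxt
  · refine (H n t x t ht.1.le htx hx01.2.le ⟨ht01, left_mem_Icc.2 htx, fun y hy =>
      ⟨by linarith [hy.1], hy.2.trans_lt hxδ.2⟩⟩).trans (le_abs_self _)
  · have h1 := H n x t t hx01.1.le hxt ht.2.le ⟨ht01, right_mem_Icc.2 hxt, fun y hy =>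
      ⟨hxδ.1.trans_le hy.1, by linarith [hy.2]⟩⟩
    rw [← norm_neg, abs_sub_comm]
    refine le_trans (le_of_eq ?_) (h1.trans (le_abs_self _))
    congr 1
    module

theorem HasMonotoneMajorants.aestronglyMeasurable [CompleteSpace E] {G g : ℝ → E}
    (h : HasMonotoneMajorants PerronTag G g) :
    AEStronglyMeasurable g (volume.restrict (Ioo (0:ℝ) 1)) := by
  refine ⟨deriv G, stronglyMeasurable_deriv G, ?_⟩
  filter_upwards [h.ae_hasDerivAt] with t ht using ht.deriv.symm

/-- A variationally McShane integrable function is Bochner integrable. -/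
theorem HasMonotoneMajorants.integrableOn [CompleteSpace E] {G g : ℝ → E}
    (h : HasMonotoneMajorants FreeTag G g) : IntegrableOn g (Ioo (0:ℝ) 1) := by
  obtain ⟨δ, hδ, V, hV, -, H⟩ := h 1 one_pos
  obtain ⟨T, hT⟩ := isCompact_Icc.elim_nhds_subcover'
    (fun t (_ : t ∈ Icc (0:ℝ) 1) => Ioo (t - δ t) (t + δ t)) fun t ht =>
      Ioo_mem_nhds (by linarith [hδ t ht]) (by linarith [hδ t ht])
  set M : ℝ := ∑ s ∈ T, ‖g s‖ with hM
  set D : ℝ → ℝ≥0∞ := hV.stieltjesFunction.measure.rnDeriv volume with hD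
  have hDint : IntegrableOn (fun t => (D t).toReal) (Ioo (0:ℝ) 1) := by
    refine integrable_toReal_of_lintegral_ne_top
      (Measure.measurable_rnDeriv _ _).aemeasurable ?_
    exact ne_top_of_le_ne_top ENNReal.ofReal_ne_top (setLIntegral_rnDeriv_stieltjes_le hV)
  have hMint : IntegrableOn (fun _ : ℝ => M) (Ioo (0:ℝ) 1) := by simp
  refine Integrable.mono' (hMint.add hDint) h.perron.aestronglyMeasurable ?_
  filter_upwards [h.perron.ae_hasDerivAt, ae_restrict_of_ae hV.ae_hasDerivAt,
    ae_restrict_mem measurableSet_Ioo] with t htG htV ht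
  obtain ⟨s, hsT, hs⟩ := mem_iUnion₂.1 (hT (Ioo_subset_Icc_self ht))
  have hF : HasDerivAt (fun v => G v - v • g s) (g t - g s) t := by
    have := htG.sub ((hasDerivAt_id t).smul_const (g (s : ℝ)))
    rw [one_smul] at this
    exact this
  have h1 := (hF.tendsto_slope.mono_left (nhdsGT_le_nhdsNE t)).norm
  have h2 := htV.tendsto_slope.mono_left (nhdsGT_le_nhdsNE t)
  have h3 : ‖g t - g s‖ ≤ (D t).toReal := by
    refine le_of_tendsto_of_tendsto h1 h2 ?_
    filter_upwards [self_mem_nhdsWithin, mem_nhdsWithin_of_mem_nhds (Iio_mem_nhds hs.2),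
      mem_nhdsWithin_of_mem_nhds (Iio_mem_nhds ht.2)] with v hv hvs hv1
    have hv : t < v := hv
    have h4 := H t v s ht.1.le hv.le (le_of_lt hv1) ⟨s.2, trivial, fun y hy =>
      ⟨hs.1.trans_le hy.1, hy.2.trans_lt hvs⟩⟩
    rw [slope_def_module, slope_def_module, norm_smul, smul_eq_mul, norm_inv, Real.norm_eq_abs,
      abs_of_pos (sub_pos.2 hv)]
    refine mul_le_mul_of_nonneg_left (le_trans (le_of_eq ?_) h4) (inv_nonneg.2 (sub_pos.2 hv).le)
    congr 1
    module
  have h5 : ‖g s‖ ≤ M :=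
    Finset.single_le_sum (f := fun s : Icc (0:ℝ) 1 => ‖g s‖) (fun _ _ => norm_nonneg _) hsT
  have h6 : ‖g t‖ ≤ ‖g s‖ + ‖g t - g s‖ := norm_le_norm_add_norm_sub' _ _
  simp only [Pi.add_apply]
  linarith

/-- The indefinite Bochner integral is a variational McShane primitive. -/
theorem _root_.MeasureTheory.Integrable.hasMonotoneMajorants [CompleteSpace E] {g : ℝ → E}
    (hg : Integrable g) : HasMonotoneMajorants FreeTag (fun x => ∫ s in (0:ℝ)..x, g s) g := by
  intro ε hε
  set η : ℝ≥0∞ := ENNReal.ofReal (ε / 4) with hη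
  have hη0 : η ≠ 0 := by simpa [hη] using hε
  obtain ⟨k, -, hgk, hkc, hki⟩ := hg.exists_hasCompactSupport_lintegral_sub_le hη0
  set p : ℝ → ℝ≥0 := fun t => ‖g t - k t‖₊ with hp
  have hpm : AEMeasurable p volume := (hg.sub hki).aestronglyMeasurable.nnnorm.aemeasurable
  obtain ⟨q, hpq, hqc, hq⟩ := exists_lt_lowerSemicontinuous_lintegral_ge_of_aemeasurable volume p hpm hη0
  have hδ : ∀ t, ∃ d > 0, ∀ s, |s - t| < d → ‖k s - k t‖ₑ ≤ η ∧ (p t : ℝ≥0∞) < q s := by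
    intro t
    have h1 : ∀ᶠ s in 𝓝 t, ‖k s - k t‖ₑ ≤ η := by
      have : Tendsto (fun s => ‖k s - k t‖ₑ) (𝓝 t) (𝓝 ‖k t - k t‖ₑ) :=
        (hkc.sub continuous_const).enorm.tendsto t
      rw [sub_self, enorm_zero] at this
      exact (this.eventually_lt_const (pos_iff_ne_zero.2 hη0)).mono fun _ => le_of_lt
    obtain ⟨d, hd, hd'⟩ := Metric.eventually_nhds_iff.1 (h1.and (hqc t _ (hpq t)))
    exact ⟨d, hd, fun s hs => hd' (by rwa [Real.dist_eq])⟩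
  choose δ hδ0 hδ using hδ
  set r : ℝ → ℝ≥0∞ := fun s => p s + η + q s with hr
  have hpη : ∫⁻ s, p s ≤ η := hgk
  have hrfin : ∀ S : Set ℝ, ∫⁻ s in S, r s ≤ 3 * η + η * volume S := by
    intro S
    calc ∫⁻ s in S, r s = ∫⁻ s in S, ((p s + q s) + η) := by
          congr 1; ext s; simp only [hr]; ring
      _ = (∫⁻ s in S, p s + q s) + η * volume S := by
          rw [lintegral_add_right _ measurable_const, setLIntegral_const]
      _ ≤ (∫⁻ s, p s + q s) + η * volume S := by
          gcongr; exact Measure.restrict_le_self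
      _ = ((∫⁻ s, p s) + ∫⁻ s, q s) + η * volume S := by
          rw [lintegral_add_right _ hqc.measurable]
      _ ≤ (η + (η + η)) + η * volume S := by
          gcongr; exact hq.trans (by gcongr)
      _ = 3 * η + η * volume S := by ring
  have hηt : η ≠ ∞ := ENNReal.ofReal_ne_top
  have hrtop : ∀ a b : ℝ, ∫⁻ s in Ioc a b, r s ≠ ∞ := fun a b =>
    ne_top_of_le_ne_top (by
      rw [Real.volume_Ioc]
      exact ENNReal.add_ne_top.2 ⟨ENNReal.mul_ne_top (by simp) hηt,
        ENNReal.mul_ne_top hηt ENNReal.ofReal_ne_top⟩) (hrfin _)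
  refine ⟨δ, fun t _ => hδ0 t, fun x => (∫⁻ s in Ioc 0 x, r s).toReal, ?_, ?_, ?_⟩
  · intro x y hxy
    exact ENNReal.toReal_mono (hrtop _ _) (lintegral_mono_set (Ioc_subset_Ioc_right hxy))
  · simp only [Ioc_self, Measure.restrict_empty, lintegral_zero_measure, ENNReal.toReal_zero,
      sub_zero]
    refine ENNReal.toReal_le_of_le_ofReal hε.le ((hrfin _).trans (le_of_eq ?_))
    rw [Real.volume_Ioc, sub_zero, ENNReal.ofReal_one, hη,
      show (3 : ℝ≥0∞) = ENNReal.ofReal 3 by simp, ← ENNReal.ofReal_mul (by norm_num), mul_one,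
      ← ENNReal.ofReal_add (by positivity) (by positivity)]
    congr 1; ring
  · intro u v t hu huv hv hadm
    have hsplit : (∫⁻ s in Ioc 0 v, r s) = (∫⁻ s in Ioc 0 u, r s) + ∫⁻ s in Ioc u v, r s := by
      rw [← Ioc_union_Ioc_eq_Ioc hu huv, lintegral_union measurableSet_Ioc]
      exact Set.disjoint_left.2 fun x hx hx' => not_lt_of_ge hx.2 hx'.1
    simp only [hsplit]
    rw [ENNReal.toReal_add (hrtop _ _) (hrtop _ _), add_sub_cancel_left,
      intervalIntegral.integral_interval_sub_left hg.intervalIntegrable hg.intervalIntegrable,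
      ← intervalIntegral.integral_const, ← intervalIntegral.integral_sub hg.intervalIntegrable
        intervalIntegrable_const, intervalIntegral.integral_of_le huv]
    rw [← toReal_enorm]
    refine ENNReal.toReal_mono (hrtop _ _) ((enorm_integral_le_lintegral_enorm _).trans ?_)
    refine setLIntegral_mono' measurableSet_Ioc fun s hs => ?_
    have hsδ := hadm.2.2 ⟨hs.1.le, hs.2⟩
    obtain ⟨h1, h2⟩ := hδ t s (abs_lt.2 ⟨by linarith [hsδ.1], by linarith [hsδ.2]⟩)
    calc ‖g s - g t‖ₑ = ‖(g s - k s) + (k s - k t) + (k t - g t)‖ₑ := by congr 1; abel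
      _ ≤ ‖g s - k s‖ₑ + ‖k s - k t‖ₑ + ‖k t - g t‖ₑ :=
          (enorm_add_le _ _).trans (by gcongr; exact enorm_add_le _ _)
      _ ≤ r s := by
          rw [← enorm_neg (k t - g t), neg_sub]
          exact add_le_add (add_le_add le_rfl h1) h2.le

/-- Two variational Henstock primitives of the same function have the same increments. -/
theorem HasMonotoneMajorants.sub_eq_sub {G H g : ℝ → E} (hG : HasMonotoneMajorants PerronTag G g)
    (hH : HasMonotoneMajorants PerronTag H g) {a b : ℝ} (ha : 0 ≤ a) (hab : a ≤ b) (hb : b ≤ 1) :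
    G b - G a = H b - H a := by
  rw [← sub_eq_zero, ← norm_le_zero_iff]
  refine le_of_forall_pos_le_add fun ε hε => ?_
  obtain ⟨δ₁, hδ₁, V, hV, hVε, h₁⟩ := hG (ε / 2) (half_pos hε)
  obtain ⟨δ₂, hδ₂, W, hW, hWε, h₂⟩ := hH (ε / 2) (half_pos hε)
  have key : ∀ {x y s : ℝ}, TaggedChain (Admissible PerronTag fun t => min (δ₁ t) (δ₂ t))
      (fun _ _ _ => 0) x y s → 0 ≤ x → y ≤ 1 → x ≤ y ∧
      ‖G y - G x - (H y - H x)‖ ≤ (V y - V x) + (W y - W x) := by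
    intro x y s h
    induction h with
    | nil a => intros; simp
    | @cons x y z t s hxy hR _ ih =>
      intro hx hz
      obtain ⟨hyz, ih⟩ := ih (hx.trans hxy) hz
      refine ⟨hxy.trans hyz, ?_⟩
      have e₁ := h₁ x y t hx hxy (hyz.trans hz) (hR.mono id (min_le_left _ _))
      have e₂ := h₂ x y t hx hxy (hyz.trans hz) (hR.mono id (min_le_right _ _))
      have e : G z - G x - (H z - H x) = (G z - G y - (H z - H y)) +
        ((G y - G x - (y - x) • g t) - (H y - H x - (y - x) • g t)) := by abel
      rw [e]
      have := norm_add_le (G z - G y - (H z - H y))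
        ((G y - G x - (y - x) • g t) - (H y - H x - (y - x) • g t))
      have := norm_sub_le (G y - G x - (y - x) • g t) (H y - H x - (y - x) • g t)
      linarith
  obtain ⟨s, hs⟩ := exists_taggedChain (C := PerronTag) (fun _ _ _ h => h)
    (δ := fun t => min (δ₁ t) (δ₂ t)) (fun t ht => lt_min (hδ₁ t ht) (hδ₂ t ht))
    (fun _ _ _ => 0) ha hab hb
  have := (key hs ha hb).2
  linarith [hV ha, hV hb, hW ha, hW hb]

/-- A variationally Henstock integrable function with integrable norm is variationally McShane
integrable, with the same primitive. -/
theorem HasMonotoneMajorants.free [CompleteSpace E] {G g : ℝ → E}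
    (h : HasMonotoneMajorants PerronTag G g) (hg : Integrable g) :
    HasMonotoneMajorants FreeTag G g := by
  intro ε hε
  obtain ⟨δ, hδ, V, hV, hVε, H⟩ := hg.hasMonotoneMajorants ε hε
  refine ⟨δ, hδ, V, hV, hVε, fun u v t hu huv hv hadm => ?_⟩
  rw [h.sub_eq_sub hg.hasMonotoneMajorants.perron hu huv hv]
  exact H u v t hu huv hv hadm

end Banach

/-! ### The Hörmander embedding of `cwk(X)` -/

section Embedding

theorem norm_le_setNorm {Y : Type*} [NormedAddCommGroup Y] {A : Set Y} (hA : Bornology.IsBounded A) {a : Y}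
    (ha : a ∈ A) :
    ‖a‖ ≤ setNorm A := by
  obtain ⟨C, hC⟩ := hA.exists_norm_le
  exact le_csSup ⟨C, forall_mem_image.2 hC⟩ (mem_image_of_mem _ ha)

theorem setNorm_le {Y : Type*} [NormedAddCommGroup Y] {A : Set Y} (hA : A.Nonempty) {r : ℝ}
    (h : ∀ a ∈ A, ‖a‖ ≤ r) :
    setNorm A ≤ r :=
  csSup_le (hA.image _) (forall_mem_image.2 h)

theorem bddAbove_image_dual {A : Set X} (hA : Bornology.IsBounded A) (x' : X →L[ℝ] ℝ) :
    BddAbove (x' '' A) :=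
  (x'.lipschitz.isBounded_image hA).bddAbove

theorem le_suppFn {A : Set X} (hA : Bornology.IsBounded A) (x' : X →L[ℝ] ℝ) {a : X} (ha : a ∈ A) :
    x' a ≤ suppFn x' A :=
  le_csSup (bddAbove_image_dual hA x') (mem_image_of_mem x' ha)

theorem suppFn_le {A : Set X} (hA : A.Nonempty) {x' : X →L[ℝ] ℝ} {r : ℝ}
    (h : ∀ a ∈ A, x' a ≤ r) : suppFn x' A ≤ r :=
  csSup_le (hA.image x') (forall_mem_image.2 h)

theorem suppFn_add {A B : Set X} (hA : A.Nonempty) (hA' : Bornology.IsBounded A)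
    (hB : B.Nonempty) (hB' : Bornology.IsBounded B) (x' : X →L[ℝ] ℝ) :
    suppFn x' (A + B) = suppFn x' A + suppFn x' B := by
  rw [suppFn, image_add, csSup_add (hA.image x') (bddAbove_image_dual hA' x') (hB.image x')
    (bddAbove_image_dual hB' x')]
  rfl

theorem suppFn_smul {c : ℝ} (hc : 0 ≤ c) (A : Set X) (x' : X →L[ℝ] ℝ) :
    suppFn x' (c • A) = c * suppFn x' A := by
  rw [suppFn, image_smul_set, Real.sSup_smul_of_nonneg hc, smul_eq_mul]
  rfl

theorem abs_apply_le_norm {x' : X →L[ℝ] ℝ} (hx' : ‖x'‖ ≤ 1) (a : X) : |x' a| ≤ ‖a‖ := by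
  simpa using x'.le_of_opNorm_le hx' a

theorem abs_suppFn_le {A : Set X} (hA : A.Nonempty) (hA' : Bornology.IsBounded A)
    {x' : X →L[ℝ] ℝ} (hx' : ‖x'‖ ≤ 1) : |suppFn x' A| ≤ setNorm A := by
  obtain ⟨a, ha⟩ := hA
  refine abs_le.2 ⟨?_, suppFn_le ⟨a, ha⟩ fun b hb => ?_⟩
  · linarith [le_suppFn hA' x' ha, neg_abs_le (x' a), abs_apply_le_norm hx' a,
      norm_le_setNorm hA' ha]
  · linarith [le_abs_self (x' b), abs_apply_le_norm hx' b, norm_le_setNorm hA' hb]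

/-- Hahn–Banach formula: the distance to a convex bounded set is controlled by support functions. -/
theorem infDist_le_of_suppFn {B : Set X} (hB : B.Nonempty) (hBc : Convex ℝ B) {a : X} {r : ℝ}
    (hr : 0 ≤ r) (h : ∀ x' : X →L[ℝ] ℝ, ‖x'‖ ≤ 1 → x' a ≤ suppFn x' B + r) :
    infDist a B ≤ r := by
  by_contra! hlt
  obtain ⟨d, hrd, hd⟩ := exists_between hlt
  have hd0 : 0 < d := hr.trans_lt hrd
  have hdisj : Disjoint (ball a d) B := by
    refine Set.disjoint_left.2 fun x hx hxB => ?_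
    have := infDist_le_dist_of_mem (x := a) hxB
    rw [mem_ball, dist_comm] at hx
    linarith
  obtain ⟨f, u, hf, hu⟩ := geometric_hahn_banach_open (convex_ball a d) isOpen_ball hBc hdisj
  have hfa : f a < u := hf a (mem_ball_self hd0)
  have hfn : ‖f‖ ≤ (u - f a) / d := by
    refine f.opNorm_le_of_unit_norm (div_nonneg (sub_pos.2 hfa).le hd0.le) fun z hz => ?_
    rw [le_div_iff₀ hd0]
    have key : ∀ z : X, ‖z‖ = 1 → f z * d ≤ u - f a := by
      intro z hz
      have hlim : Filter.Tendsto (fun s : ℝ => f a + s * f z) (nhdsWithin d (Iio d))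
          (nhds (f a + d * f z)) :=
        (Continuous.tendsto (by fun_prop) d).mono_left nhdsWithin_le_nhds
      have hle : f a + d * f z ≤ u := by
        refine le_of_tendsto hlim ?_
        filter_upwards [Ioo_mem_nhdsLT hd0] with s hs
        have := hf (a + s • z) (by simp [norm_smul, hz, abs_of_pos hs.1, hs.2])
        simpa using this.le
      linarith
    have k₁ := key z hz
    have k₂ := key (-z) (by simpa using hz)
    rw [map_neg] at k₂
    rw [Real.norm_eq_abs]
    rcases abs_choice (f z) with e | e <;> rw [e] <;> assumption
  have hpos : 0 < (u - f a) / d := div_pos (sub_pos.2 hfa) hd0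
  set c := (u - f a) / d with hc
  have hcd : c * d = u - f a := div_mul_cancel₀ _ hd0.ne'
  have hx' : ‖-(c⁻¹ • f)‖ ≤ 1 := by
    rw [norm_neg, norm_smul, norm_inv, Real.norm_eq_abs, abs_of_pos hpos]
    exact (inv_mul_le_one₀ hpos).2 hfn
  have h1 := h _ hx'
  have h2 : suppFn (-(c⁻¹ • f)) B ≤ -(c⁻¹ * u) := by
    refine suppFn_le hB fun b hb => ?_
    have := mul_le_mul_of_nonneg_left (hu b hb) (inv_nonneg.2 hpos.le)
    simpa using this
  have h3 : (-(c⁻¹ • f)) a = -(c⁻¹ * f a) := by simp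
  have h4 : c⁻¹ * u - c⁻¹ * f a = d := by
    rw [← mul_sub, ← hcd, inv_mul_cancel_left₀ hpos.ne']
  linarith

/-- Nonempty, convex and bounded sets. -/
structure IsConvexBounded (A : Set X) : Prop where
  nonempty : A.Nonempty
  convex : Convex ℝ A
  bounded : Bornology.IsBounded A

theorem IsConvexBounded.smul {A : Set X} (hA : IsConvexBounded A) (c : ℝ) :
    IsConvexBounded (c • A) :=
  ⟨hA.nonempty.smul_set, hA.convex.smul c, hA.bounded.smul₀ c⟩

/-- Weakly compact sets are norm bounded. -/
theorem IsCWK.isConvexBounded {A : Set X} (hA : IsCWK X A) : IsConvexBounded A := by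
  refine ⟨hA.1, hA.2.1, ?_⟩
  have hpt : ∀ x' : StrongDual ℝ X, ∃ C, ∀ a : A,
      ‖NormedSpace.inclusionInDoubleDual ℝ X a x'‖ ≤ C := by
    intro x'
    have hcont : Continuous fun y : WeakSpace ℝ X => x' ((toWeakSpace ℝ X).symm y) :=
      WeakBilin.eval_continuous (topDualPairing ℝ X).flip x'
    obtain ⟨C, hC⟩ := (hA.2.2.image hcont).isBounded.exists_norm_le
    refine ⟨C, fun a => hC _ ?_⟩
    exact ⟨toWeakSpace ℝ X a, mem_image_of_mem _ a.2, by simp⟩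
  obtain ⟨C, hC⟩ := banach_steinhaus hpt
  refine isBounded_iff_forall_norm_le.2 ⟨C, fun a ha => ?_⟩
  have := hC ⟨a, ha⟩
  rwa [← (NormedSpace.inclusionInDoubleDualLi ℝ (E := X)).norm_map a]

variable (X) in
/-- The closed unit ball of the dual. -/
abbrev DualBall : Type _ := {x' : X →L[ℝ] ℝ // ‖x'‖ ≤ 1}

variable (X) in
/-- The Banach space `ℓ^∞(B_{X*})`. -/
abbrev DualBallSpace : Type _ := lp (fun _ : DualBall X => ℝ) ∞

open Classical in
/-- The Hörmander embedding, sending a set to its support function on the dual ball. -/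
noncomputable def hormander (A : Set X) : DualBallSpace X :=
  if h : Memℓp (fun x' : DualBall X => suppFn (x' : X →L[ℝ] ℝ) A) ∞ then ⟨_, h⟩ else 0

theorem IsConvexBounded.hormander_apply {A : Set X} (hA : IsConvexBounded A) (x' : DualBall X) :
    hormander A x' = suppFn (x' : X →L[ℝ] ℝ) A := by
  have h : Memℓp (fun x' : DualBall X => suppFn (x' : X →L[ℝ] ℝ) A) ∞ :=
    memℓp_infty ⟨setNorm A, forall_mem_range.2 fun x' =>
      abs_suppFn_le hA.nonempty hA.bounded x'.2⟩
  rw [hormander, dif_pos h]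

theorem IsConvexBounded.norm_hormander {A : Set X} (hA : IsConvexBounded A) :
    ‖hormander A‖ = setNorm A := by
  have h0 : 0 ≤ setNorm A := Real.sSup_nonneg (forall_mem_image.2 fun _ _ => norm_nonneg _)
  refine le_antisymm (lp.norm_le_of_forall_le h0 fun x' => ?_)
    (setNorm_le hA.nonempty fun a ha => ?_)
  · rw [hA.hormander_apply]
    exact abs_suppFn_le hA.nonempty hA.bounded x'.2
  · obtain ⟨f, hf, hfa⟩ := exists_dual_vector'' ℝ a
    have h1 := lp.norm_apply_le_norm ENNReal.top_ne_zero (hormander A) ⟨f, hf⟩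
    rw [hA.hormander_apply] at h1
    have h2 := le_suppFn hA.bounded f ha
    have h3 : f a = ‖a‖ := hfa
    exact (h3.symm.le.trans h2).trans ((le_abs_self _).trans h1)

theorem IsConvexBounded.norm_hormander_sub {A B : Set X} (hA : IsConvexBounded A)
    (hB : IsConvexBounded B) : ‖hormander A - hormander B‖ = hausdorffDist A B := by
  have one_sided : ∀ {A B : Set X}, IsConvexBounded A → IsConvexBounded B →
      ∀ x' : X →L[ℝ] ℝ, ‖x'‖ ≤ 1 → suppFn x' A - suppFn x' B ≤ hausdorffDist A B := by
    intro A B hA hB x' hx'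
    refine le_of_forall_pos_le_add fun ε hε => ?_
    rw [sub_le_iff_le_add]
    refine suppFn_le hA.nonempty fun a ha => ?_
    obtain ⟨b, hb, hab⟩ := exists_dist_lt_of_hausdorffDist_lt ha (lt_add_of_pos_right _ hε)
      (hausdorffEDist_ne_top_of_nonempty_of_bounded hA.nonempty hB.nonempty hA.bounded hB.bounded)
    have h1 := abs_apply_le_norm hx' (a - b)
    rw [map_sub, ← dist_eq_norm] at h1
    linarith [le_abs_self (x' a - x' b), le_suppFn hB.bounded x' hb]
  have dist_le : ∀ {A B : Set X}, IsConvexBounded A → IsConvexBounded B →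
      ∀ a ∈ A, infDist a B ≤ ‖hormander A - hormander B‖ := by
    intro A B hA hB a ha
    refine infDist_le_of_suppFn hB.nonempty hB.convex (norm_nonneg _) fun x' hx' => ?_
    have h1 := lp.norm_apply_le_norm ENNReal.top_ne_zero (hormander A - hormander B) ⟨x', hx'⟩
    rw [lp.coeFn_sub, Pi.sub_apply, hA.hormander_apply, hB.hormander_apply,
      Real.norm_eq_abs] at h1
    linarith [le_abs_self (suppFn x' A - suppFn x' B), le_suppFn hA.bounded x' ha]
  refine le_antisymm (lp.norm_le_of_forall_le hausdorffDist_nonneg fun x' => ?_)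
    (hausdorffDist_le_of_infDist (norm_nonneg _) (dist_le hA hB) fun b hb => ?_)
  · rw [lp.coeFn_sub, Pi.sub_apply, hA.hormander_apply, hB.hormander_apply, Real.norm_eq_abs]
    refine abs_sub_le_iff.2 ⟨one_sided hA hB x' x'.2, ?_⟩
    rw [hausdorffDist_comm]
    exact one_sided hB hA x' x'.2
  · rw [norm_sub_rev]
    exact dist_le hB hA b hb

theorem IsConvexBounded.add {A B : Set X} (hA : IsConvexBounded A) (hB : IsConvexBounded B) :
    IsConvexBounded (A + B) :=
  ⟨hA.nonempty.add hB.nonempty, hA.convex.add hB.convex, hA.bounded.add hB.bounded⟩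

theorem IsConvexBounded.hormander_add {A B : Set X} (hA : IsConvexBounded A)
    (hB : IsConvexBounded B) : hormander (A + B) = hormander A + hormander B := by
  ext x'
  rw [lp.coeFn_add, Pi.add_apply, (hA.add hB).hormander_apply, hA.hormander_apply,
    hB.hormander_apply, suppFn_add hA.nonempty hA.bounded hB.nonempty hB.bounded]

theorem IsConvexBounded.hormander_smul {A : Set X} (hA : IsConvexBounded A) {c : ℝ}
    (hc : 0 ≤ c) : hormander (c • A) = c • hormander A := by
  ext x'
  rw [lp.coeFn_smul, Pi.smul_apply, (hA.smul c).hormander_apply, hA.hormander_apply,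
    suppFn_smul hc, smul_eq_mul]

end Embedding

/-! ### Transfer to the Banach space of the embedding -/

section Transfer

/-- `Φ` is a variational primitive of `Γ` with respect to partitions whose tags satisfy `C`. -/
def IsVariationalPrimitive (C : ℝ → ℝ → ℝ → Prop) (Γ : ℝ → Set X) (Φ : ℝ → ℝ → Set X) : Prop :=
  ∀ ε > 0, ∃ δ : ℝ → ℝ, IsGauge δ ∧ ∀ (n : ℕ) (P : TP n),
    (∀ i : Fin n, C (P.pt i.castSucc) (P.pt i.succ) (P.tag i)) → P.IsFine δ →
    ∑ i : Fin n, hausdorffDist (Φ (P.pt i.castSucc) (P.pt i.succ)) (P.len i • Γ (P.tag i)) < ε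

/-- The point function on `[0,1]` generating an interval multifunction in the embedding. -/
noncomputable def primitiveFn (Φ : ℝ → ℝ → Set X) (x : ℝ) : DualBallSpace X := hormander (Φ 0 x)

/-- A multifunction on `[0,1]` read in the embedding, extended by `0`. -/
noncomputable def densityFn (Γ : ℝ → Set X) : ℝ → DualBallSpace X :=
  (Icc (0:ℝ) 1).indicator fun t => hormander (Γ t)

variable {Γ : ℝ → Set X} {Φ : ℝ → ℝ → Set X}

theorem hausdorffDist_eq_norm (hΓ : ∀ t ∈ Icc (0:ℝ) 1, IsCWK X (Γ t))
    (hΦ : ∀ a b : ℝ, 0 ≤ a → a ≤ b → b ≤ 1 → IsCWK X (Φ a b)) (hadd : AdditiveIntervalMF Φ)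
    {u v t : ℝ} (hu : 0 ≤ u) (huv : u ≤ v) (hv : v ≤ 1) (ht : t ∈ Icc (0:ℝ) 1) :
    hausdorffDist (Φ u v) ((v - u) • Γ t) =
      ‖primitiveFn Φ v - primitiveFn Φ u - (v - u) • densityFn Γ t‖ := by
  have h0u := (hΦ 0 u le_rfl hu (huv.trans hv)).isConvexBounded
  have huv' := (hΦ u v hu huv hv).isConvexBounded
  have hΓt := (hΓ t ht).isConvexBounded
  rw [← huv'.norm_hormander_sub (hΓt.smul _), hΓt.hormander_smul (sub_nonneg.2 huv), densityFn,
    indicator_of_mem ht, primitiveFn, primitiveFn, hadd 0 u v le_rfl hu huv hv,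
    h0u.hormander_add huv', add_sub_cancel_left]

theorem TP.pt_mem {n : ℕ} (P : TP n) (i : Fin (n + 1)) : P.pt i ∈ Icc (0:ℝ) 1 :=
  ⟨P.first ▸ P.mono (Fin.zero_le i), P.last ▸ P.mono (Fin.le_last i)⟩

theorem TP.pt_le {n : ℕ} (P : TP n) (i : Fin n) : P.pt i.castSucc ≤ P.pt i.succ :=
  P.mono (Fin.castSucc_lt_succ (i := i)).le

theorem TP.sum_sub {n : ℕ} (P : TP n) (V : ℝ → ℝ) :
    ∑ i : Fin n, (V (P.pt i.succ) - V (P.pt i.castSucc)) = V 1 - V 0 := by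
  have h₁ := Fin.sum_univ_succ fun i => V (P.pt i)
  have h₂ := Fin.sum_univ_castSucc fun i => V (P.pt i)
  rw [P.first] at h₁
  rw [P.last] at h₂
  rw [Finset.sum_sub_distrib]
  linarith

theorem isVariationalPrimitive_iff {C : ℝ → ℝ → ℝ → Prop} (hC : ∀ u v t, t ∈ Icc u v → C u v t)
    (hΓ : ∀ t ∈ Icc (0:ℝ) 1, IsCWK X (Γ t))
    (hΦ : ∀ a b : ℝ, 0 ≤ a → a ≤ b → b ≤ 1 → IsCWK X (Φ a b)) (hadd : AdditiveIntervalMF Φ) :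
    IsVariationalPrimitive C Γ Φ ↔ HasMonotoneMajorants C (primitiveFn Φ) (densityFn Γ) := by
  have hsum : ∀ {n : ℕ} (P : TP n),
      ∑ i : Fin n, hausdorffDist (Φ (P.pt i.castSucc) (P.pt i.succ)) (P.len i • Γ (P.tag i)) =
      ∑ i : Fin n, ‖primitiveFn Φ (P.pt i.succ) - primitiveFn Φ (P.pt i.castSucc) -
        (P.pt i.succ - P.pt i.castSucc) • densityFn Γ (P.tag i)‖ := fun P =>
    Finset.sum_congr rfl fun i _ => hausdorffDist_eq_norm hΓ hΦ hadd (P.pt_mem _).1 (P.pt_le i)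
      (P.pt_mem _).2 (P.tagMem i)
  constructor
  · intro h ε hε
    obtain ⟨δ, hδ, H⟩ := h ε hε
    refine ⟨δ, hδ, exists_monotone_majorant hC hδ (w := fun u v t =>
      ‖primitiveFn Φ v - primitiveFn Φ u - (v - u) • densityFn Γ t‖)
      (fun _ _ _ _ => norm_nonneg _) fun n P hP hf => ?_⟩
    rw [← hsum]
    exact H n P hP hf
  · intro h ε hε
    obtain ⟨δ, hδ, V, hV, hVε, H⟩ := h (ε / 2) (half_pos hε)
    refine ⟨δ, hδ, fun n P hP hf => ?_⟩
    rw [hsum]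
    calc _ ≤ ∑ i : Fin n, (V (P.pt i.succ) - V (P.pt i.castSucc)) :=
          Finset.sum_le_sum fun i _ => H _ _ _ (P.pt_mem _).1 (P.pt_le i) (P.pt_mem _).2
            ⟨P.tagMem i, hP i, hf i⟩
      _ = V 1 - V 0 := P.sum_sub V
      _ < ε := by linarith

theorem vHIntegrable_iff (hΓ : ∀ t ∈ Icc (0:ℝ) 1, IsCWK X (Γ t)) :
    vHIntegrable Γ ↔ ∃ Φ : ℝ → ℝ → Set X,
      (∀ a b : ℝ, 0 ≤ a → a ≤ b → b ≤ 1 → IsCWK X (Φ a b)) ∧ AdditiveIntervalMF Φ ∧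
      HasMonotoneMajorants PerronTag (primitiveFn Φ) (densityFn Γ) :=
  exists_congr fun _ => and_congr_right fun hΦ => and_congr_right fun hadd =>
    isVariationalPrimitive_iff (C := PerronTag) (fun _ _ _ h => h) hΓ hΦ hadd

theorem vMSIntegrable_iff (hΓ : ∀ t ∈ Icc (0:ℝ) 1, IsCWK X (Γ t)) :
    vMSIntegrable Γ ↔ ∃ Φ : ℝ → ℝ → Set X,
      (∀ a b : ℝ, 0 ≤ a → a ≤ b → b ≤ 1 → IsCWK X (Φ a b)) ∧ AdditiveIntervalMF Φ ∧
      HasMonotoneMajorants FreeTag (primitiveFn Φ) (densityFn Γ) := by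
  refine exists_congr fun _ => and_congr_right fun hΦ => and_congr_right fun hadd => ?_
  rw [← isVariationalPrimitive_iff (C := FreeTag) (fun _ _ _ _ => trivial) hΓ hΦ hadd]
  simp only [IsVariationalPrimitive, FreeTag, implies_true, forall_const]

theorem norm_densityFn (hΓ : ∀ t ∈ Icc (0:ℝ) 1, IsCWK X (Γ t)) {t : ℝ} (ht : t ∈ Icc (0:ℝ) 1) :
    ‖densityFn Γ t‖ = setNorm (Γ t) := by
  rw [densityFn, indicator_of_mem ht, (hΓ t ht).isConvexBounded.norm_hormander]

end Transfer

/-- Theorem `t10` of the paper. A multifunction `Γ : [0,1] → cwk(X)` is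
variationally McShane integrable if and only if it is variationally Henstock integrable and
integrably bounded. -/
theorem vMS_iff_vH_and_integrablyBounded
    {X : Type*} [NormedAddCommGroup X] [NormedSpace ℝ X] [CompleteSpace X]
    (Γ : ℝ → Set X) (hΓ : ∀ t ∈ Icc (0:ℝ) 1, IsCWK X (Γ t)) :
    vMSIntegrable Γ ↔
      (vHIntegrable Γ ∧ IntegrableOn (fun t => setNorm (Γ t)) (Icc (0:ℝ) 1) volume) := by
  rw [vMSIntegrable_iff hΓ, vHIntegrable_iff hΓ]
  have hnorm : IntegrableOn (fun t => setNorm (Γ t)) (Icc (0:ℝ) 1) volume ↔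
      IntegrableOn (fun t => ‖densityFn Γ t‖) (Icc (0:ℝ) 1) volume :=
    integrableOn_congr_fun (fun t ht => (norm_densityFn hΓ ht).symm) measurableSet_Icc
  rw [hnorm]
  constructor
  · rintro ⟨Φ, hΦ, hadd, h⟩
    exact ⟨⟨Φ, hΦ, hadd, h.perron⟩,
      ((integrableOn_Icc_iff_integrableOn_Ioo (f := densityFn Γ)).2 h.integrableOn).norm⟩
  · rintro ⟨⟨Φ, hΦ, hadd, h⟩, hint⟩
    refine ⟨Φ, hΦ, hadd, h.free ?_⟩
    have hon : IntegrableOn (densityFn Γ) (Icc (0:ℝ) 1) :=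
      (integrable_norm_iff (by
        rw [← restrict_Ioo_eq_restrict_Icc]; exact h.aestronglyMeasurable)).1 hint
    refine (integrableOn_iff_integrable_of_support_subset ?_).1 hon
    exact support_indicator_subset

end GaugePaper
end

section
/- Let X be a Banach space. A function f : [0,1] → X is variationally McShane integrable (equivalently, Bochner integrable) if and only if it is variationally Henstock integrable and integrably bounded (i.e. t ↦ ‖f(t)‖ is Lebesgue integrable). -/
open Set Metric MeasureTheory Pointwise
open scoped ENNReal NNReal

namespace GaugePaper

variable (X : Type*) [NormedAddCommGroup X] [NormedSpace ℝ X]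

variable {X}

/-! ### Perron chains -/

/-- `PerronChain δ w a b s`: the interval `[a, b]` has a `δ`-fine Perron partition, all of whose
tags lie in `[0,1]`, and for which the sum of the weights `w u v t` of its intervals `[u, v]` with
tags `t` equals `s`. -/
inductive PerronChain (δ : ℝ → ℝ) (w : ℝ → ℝ → ℝ → ℝ) : ℝ → ℝ → ℝ → Prop
  | nil (a : ℝ) : PerronChain δ w a a 0
  | cons {a t b c s : ℝ} (ht : t ∈ Icc (0:ℝ) 1) (hat : a ≤ t) (htb : t ≤ b)
      (ha : t - δ t < a) (hb : b < t + δ t) (h : PerronChain δ w b c s) :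
      PerronChain δ w a c (w a b t + s)

namespace PerronChain

variable {δ : ℝ → ℝ} {w : ℝ → ℝ → ℝ → ℝ}

theorem append {a b c s s' : ℝ} (h : PerronChain δ w a b s) (h' : PerronChain δ w b c s') :
    PerronChain δ w a c (s + s') := by
  induction h with
  | nil a => simpa using h'
  | cons ht hat htb ha hb _ ih => rw [add_assoc]; exact cons ht hat htb ha hb (ih h')

theorem single {a t b : ℝ} (ht : t ∈ Icc (0:ℝ) 1) (hat : a ≤ t) (htb : t ≤ b)
    (ha : t - δ t < a) (hb : b < t + δ t) : PerronChain δ w a b (w a b t) := by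
  simpa using cons ht hat htb ha hb (nil b)

theorem nonneg (hw : ∀ u v t, 0 ≤ w u v t) {a b s : ℝ} (h : PerronChain δ w a b s) : 0 ≤ s := by
  induction h with
  | nil a => exact le_rfl
  | cons _ _ _ _ _ _ ih => exact add_nonneg (hw _ _ _) ih

/-- Cousin's lemma: every subinterval of `[0,1]` has a `δ`-fine Perron partition. -/
theorem exists_of_isGauge (hδ : IsGauge δ) {a b : ℝ} (ha : 0 ≤ a) (hab : a ≤ b) (hb : b ≤ 1) :
    ∃ s, PerronChain δ w a b s := by
  set S : Set ℝ := {x | x ∈ Icc a b ∧ ∃ s, PerronChain δ w a x s} with hS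
  have haS : a ∈ S := ⟨⟨le_rfl, hab⟩, 0, nil a⟩
  have hbdd : BddAbove S := ⟨b, fun x hx => hx.1.2⟩
  have ham : a ≤ sSup S := le_csSup hbdd haS
  have hmb : sSup S ≤ b := csSup_le ⟨a, haS⟩ fun x hx => hx.1.2
  have hm : sSup S ∈ Icc (0:ℝ) 1 := ⟨ha.trans ham, hmb.trans hb⟩
  have hpos := hδ _ hm
  obtain ⟨y, ⟨hy, s, hs⟩, hylt⟩ := exists_lt_of_lt_csSup ⟨a, haS⟩ (sub_lt_self (sSup S) hpos)
  have hym : y ≤ sSup S := le_csSup hbdd ⟨hy, s, hs⟩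
  have hmS := hs.append (single hm hym le_rfl hylt (by linarith))
  rcases hmb.eq_or_lt with h | h
  · exact h ▸ ⟨_, hmS⟩
  · exfalso
    set z := min b (sSup S + δ (sSup S) / 2) with hz
    have hmz : sSup S < z := lt_min h (by linarith)
    have hzδ : z < sSup S + δ (sSup S) := (min_le_right _ _).trans_lt (by linarith)
    have hzS : z ∈ S := ⟨⟨ham.trans hmz.le, min_le_left _ _⟩, _,
      hmS.append (single hm le_rfl hmz.le (by linarith) hzδ)⟩
    exact absurd (le_csSup hbdd hzS) (not_le.2 hmz)

theorem exists_seq {a b s : ℝ} (h : PerronChain δ w a b s) :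
    ∃ (n : ℕ) (x t : ℕ → ℝ), x 0 = a ∧ x n = b ∧
      (∀ i < n, t i ∈ Icc (0:ℝ) 1 ∧ x i ≤ t i ∧ t i ≤ x (i + 1) ∧
        t i - δ (t i) < x i ∧ x (i + 1) < t i + δ (t i)) ∧
      ∑ i ∈ Finset.range n, w (x i) (x (i + 1)) (t i) = s := by
  induction h with
  | nil a => exact ⟨0, fun _ => a, fun _ => a, by simp⟩
  | @cons a t b c s ht hat htb ha hb _ ih =>
    obtain ⟨n, x, u, h0, hn, hi, hs⟩ := ih
    refine ⟨n + 1, fun i => i.casesOn a x, fun i => i.casesOn t u, rfl, hn, ?_, ?_⟩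
    · rintro (_ | i) hlt
      · simp only [h0]
        exact ⟨ht, hat, htb, ha, hb⟩
      · exact hi i (by omega)
    · rw [Finset.sum_range_succ', add_comm]
      simp only [h0, hs]
      rfl

theorem exists_TP {s : ℝ} (h : PerronChain δ w 0 1 s) :
    ∃ (n : ℕ) (P : TP n), P.IsPerron ∧ P.IsFine δ ∧
      ∑ i : Fin n, w (P.pt i.castSucc) (P.pt i.succ) (P.tag i) = s := by
  obtain ⟨n, x, t, h0, hn, hi, hs⟩ := h.exists_seq
  refine ⟨n, ⟨fun i => x i, fun i => t i, ?_, by simpa using h0, by simpa using hn,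
    fun i => (hi i i.2).1⟩, fun i => ?_, fun i y hy => ?_, ?_⟩
  · refine Fin.monotone_iff_le_succ.2 fun i => ?_
    obtain ⟨-, h1, h2, -⟩ := hi i i.2
    simpa using h1.trans h2
  · obtain ⟨-, h1, h2, -⟩ := hi i i.2
    exact ⟨by simpa using h1, by simpa using h2⟩
  · obtain ⟨-, -, -, h1, h2⟩ := hi i i.2
    obtain ⟨hy1, hy2⟩ := hy
    simp only [Fin.val_castSucc, Fin.val_succ] at hy1 hy2
    exact ⟨h1.trans_le hy1, hy2.trans_lt h2⟩
  · simp only [Fin.val_castSucc, Fin.val_succ]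
    rw [← hs, Finset.sum_range]

end PerronChain

/-! ### Difference quotients over uniform partitions -/

/-- The difference quotient of the interval function `Φ` over the interval of the form
`[k / N, (k + 1) / N]` that contains `t`. -/
noncomputable def stepQuotient (Φ : ℝ → ℝ → X) (N : ℕ) (t : ℝ) : X :=
  (N : ℝ) • Φ (⌊(N : ℝ) * t⌋₊ / N) ((⌊(N : ℝ) * t⌋₊ + 1) / N)

theorem stronglyMeasurable_stepQuotient (Φ : ℝ → ℝ → X) (N : ℕ) :
    StronglyMeasurable (stepQuotient Φ N) := by
  have h : StronglyMeasurable fun k : ℕ => (N : ℝ) • Φ (k / N) ((k + 1) / N) := .of_discrete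
  exact h.comp_measurable (Nat.measurable_floor.comp (measurable_const_mul (N : ℝ)))

theorem mem_Ico_of_floor_eq {N k : ℕ} (hN : 0 < N) {t : ℝ} (ht : 0 ≤ t)
    (h : ⌊(N : ℝ) * t⌋₊ = k) : t ∈ Ico ((k : ℝ) / N) ((k + 1) / N) := by
  have hN' : (0 : ℝ) < N := by exact_mod_cast hN
  obtain ⟨h1, h2⟩ := (Nat.floor_eq_iff (by positivity)).1 h
  exact ⟨(div_le_iff₀ hN').2 (by linarith), (lt_div_iff₀ hN').2 (by linarith)⟩

theorem volume_Ico_div (N k : ℕ) :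
    volume (Ico ((k : ℝ) / N) ((k + 1) / N)) = ENNReal.ofReal (1 / N) := by
  rw [Real.volume_Ico, ← sub_div, add_sub_cancel_left]

theorem card_mul_lt_of_deviation {f : ℝ → X} {Φ : ℝ → ℝ → X} {δ : ℝ → ℝ} {ε η : ℝ}
    (hδ : IsGauge δ)
    (hsum : ∀ (n : ℕ) (P : TP n), P.IsPerron → P.IsFine δ →
      ∑ i : Fin n, ‖Φ (P.pt i.castSucc) (P.pt i.succ) - P.len i • f (P.tag i)‖ < ε)
    {N : ℕ} (hN : 0 < N) (K : Finset ℕ) (hK : K ⊆ Finset.range N)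
    (hdev : ∀ k ∈ K, ∃ t ∈ Ico (0 : ℝ) 1, ⌊(N : ℝ) * t⌋₊ = k ∧ 1 / N < δ t ∧
      η ≤ ‖stepQuotient Φ N t - f t‖) :
    K.card * (η / N) < ε := by
  have hN' : (0 : ℝ) < N := by exact_mod_cast hN
  set w : ℝ → ℝ → ℝ → ℝ := fun u v t => ‖Φ u v - (v - u) • f t‖ with hw
  have hw0 : ∀ u v t, 0 ≤ w u v t := fun u v t => norm_nonneg _
  have key : ∀ m ≤ N, ∃ s, PerronChain δ w 0 ((m : ℝ) / N) s ∧
      ∑ k ∈ Finset.range m, (if k ∈ K then η / N else 0) ≤ s := by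
    intro m
    induction m with
    | zero => exact fun _ => ⟨0, by simpa using PerronChain.nil 0, by simp⟩
    | succ m ih =>
      intro hm
      obtain ⟨s, hs, hle⟩ := ih (by omega)
      rw [Finset.sum_range_succ]
      push_cast
      have hm1 : ((m : ℝ) + 1) / N ≤ 1 := (div_le_one hN').2 (by exact_mod_cast hm)
      have hlen : ((m : ℝ) + 1) / N - m / N = 1 / N := by ring
      split_ifs with hmK
      · obtain ⟨t, ht, hfl, htδ, hη⟩ := hdev m hmK
        obtain ⟨h1, h2⟩ := mem_Ico_of_floor_eq hN ht.1 hfl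
        refine ⟨_, hs.append (PerronChain.single ⟨ht.1, ht.2.le⟩ h1 h2.le ?_ ?_),
          add_le_add hle ?_⟩
        · linarith
        · linarith
        · have : stepQuotient Φ N t - f t =
              (N : ℝ) • (Φ (m / N) ((m + 1) / N) - (((m : ℝ) + 1) / N - m / N) • f t) := by
            rw [stepQuotient, hfl, smul_sub, smul_smul, hlen, mul_one_div_cancel hN'.ne', one_smul]
          rw [this, norm_smul, Real.norm_of_nonneg hN'.le] at hη
          rw [div_le_iff₀ hN', mul_comm]
          exact hη
      · obtain ⟨s', hs'⟩ := PerronChain.exists_of_isGauge (w := w) hδ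
          (a := (m : ℝ) / N) (b := (m + 1) / N) (by positivity) (by linarith [one_div_pos.2 hN'])
          hm1
        exact ⟨_, hs.append hs', add_le_add hle (hs'.nonneg hw0)⟩
  obtain ⟨s, hs, hle⟩ := key N le_rfl
  rw [div_self hN'.ne'] at hs
  obtain ⟨n, P, hP, hfine, hsP⟩ := hs.exists_TP
  rw [Finset.sum_ite_mem, Finset.inter_eq_right.2 hK, Finset.sum_const, nsmul_eq_mul] at hle
  exact (hle.trans_eq hsP.symm).trans_lt (hsum n P hP hfine)

theorem volume_deviation_le {f : ℝ → X} {Φ : ℝ → ℝ → X} {δ : ℝ → ℝ} {ε η : ℝ}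
    (hδ : IsGauge δ) (hη : 0 < η)
    (hsum : ∀ (n : ℕ) (P : TP n), P.IsPerron → P.IsFine δ →
      ∑ i : Fin n, ‖Φ (P.pt i.castSucc) (P.pt i.succ) - P.len i • f (P.tag i)‖ < ε)
    {N : ℕ} (hN : 0 < N) :
    volume {t ∈ Ico (0 : ℝ) 1 | 1 / N < δ t ∧ η ≤ ‖stepQuotient Φ N t - f t‖} ≤
      ENNReal.ofReal (ε / η) := by
  classical
  have hN' : (0 : ℝ) < N := by exact_mod_cast hN
  set A := {t ∈ Ico (0 : ℝ) 1 | 1 / N < δ t ∧ η ≤ ‖stepQuotient Φ N t - f t‖} with hA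
  set K := (Finset.range N).filter fun k => ∃ t ∈ A, ⌊(N : ℝ) * t⌋₊ = k with hK
  have hcard := card_mul_lt_of_deviation hδ hsum hN K (Finset.filter_subset _ _) fun k hk => by
    obtain ⟨t, ht, hfl⟩ := (Finset.mem_filter.1 hk).2
    exact ⟨t, ht.1, hfl, ht.2⟩
  have hsub : A ⊆ ⋃ k ∈ K, Ico ((k : ℝ) / N) ((k + 1) / N) := fun t ht => by
    refine mem_iUnion₂.2 ⟨⌊(N : ℝ) * t⌋₊, Finset.mem_filter.2 ⟨Finset.mem_range.2 ?_, t, ht, rfl⟩,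
      mem_Ico_of_floor_eq hN ht.1.1 rfl⟩
    exact (Nat.floor_lt (mul_nonneg hN'.le ht.1.1)).2 (by nlinarith [ht.1.2])
  calc volume A ≤ ∑ k ∈ K, volume (Ico ((k : ℝ) / N) ((k + 1) / N)) :=
        (measure_mono hsub).trans (measure_biUnion_finset_le _ _)
    _ = ENNReal.ofReal (K.card * (1 / N)) := by
        simp_rw [volume_Ico_div]
        rw [Finset.sum_const, nsmul_eq_mul, ENNReal.ofReal_mul (by positivity),
          ENNReal.ofReal_natCast]
    _ ≤ ENNReal.ofReal (ε / η) := by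
        refine ENNReal.ofReal_le_ofReal ((le_div_iff₀ hη).2 ?_)
        calc (K.card : ℝ) * (1 / N) * η = K.card * (η / N) := by ring
          _ ≤ ε := hcard.le

theorem FvHPrimitive.tendstoInMeasure_stepQuotient {f : ℝ → X} {Φ : ℝ → ℝ → X}
    (h : FvHPrimitive f Φ) :
    TendstoInMeasure (volume.restrict (Ico (0 : ℝ) 1)) (stepQuotient Φ) Filter.atTop f := by
  set μ := volume.restrict (Ico (0 : ℝ) 1) with hμ
  have hμ1 : μ univ = 1 := by simp [hμ]
  have : IsFiniteMeasure μ := ⟨by rw [hμ1]; exact ENNReal.one_lt_top⟩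
  rw [tendstoInMeasure_iff_norm]
  intro η hη
  rw [ENNReal.tendsto_nhds_zero]
  intro κ hκ
  rcases eq_or_ne κ ⊤ with rfl | hκtop
  · exact Filter.Eventually.of_forall fun _ => le_top
  have hκ' : 0 < κ.toReal := ENNReal.toReal_pos hκ.ne' hκtop
  obtain ⟨δ, hδ, hsum⟩ := h.2 (κ.toReal / 4 * (η / 4)) (by positivity)
  set Bad : ℕ → Set ℝ := fun M => {t | 1 / (M : ℝ) < δ t ∧ η / 4 ≤ ‖stepQuotient Φ M t - f t‖}
    with hBad
  have hBadle : ∀ M : ℕ, 0 < M → μ (Bad M) ≤ κ / 4 := fun M hM => by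
    have h1 := volume_deviation_le hδ (by positivity : 0 < η / 4) hsum hM
    rw [mul_div_cancel_right₀ _ (by positivity), ENNReal.ofReal_div_of_pos (by norm_num),
      ENNReal.ofReal_toReal hκtop, ENNReal.ofReal_ofNat] at h1
    rw [hμ, Measure.restrict_apply' measurableSet_Ico]
    refine le_trans (measure_mono ?_) h1
    exact fun t ht => ⟨ht.2, ht.1⟩
  set D : ℕ → Set ℝ := fun n => {t | 1 / ((n : ℝ) + 1) < δ t} with hD
  have hDmono : Monotone D := fun m n hmn t ht => by
    have hmn' : (m : ℝ) + 1 ≤ n + 1 := by gcongr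
    exact (one_div_le_one_div_of_le (by positivity) hmn').trans_lt ht
  have hDcover : Ico (0 : ℝ) 1 ⊆ ⋃ n, D n := fun t ht =>
    mem_iUnion.2 (exists_nat_one_div_lt (hδ t ⟨ht.1, ht.2.le⟩))
  have hDlim : Filter.Tendsto (fun n => 1 - μ (D n)) Filter.atTop (nhds 0) := by
    have h1 : μ (⋃ n, D n) = 1 := by
      rw [hμ, Measure.restrict_apply' measurableSet_Ico, inter_eq_right.2 hDcover]
      simp
    have h2 := tendsto_measure_iUnion_atTop (μ := μ) hDmono
    rw [h1] at h2
    simpa using ENNReal.Tendsto.sub tendsto_const_nhds h2 (Or.inl ENNReal.one_ne_top)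
  have hκ4 : 0 < κ / 4 := ENNReal.div_pos hκ.ne' (by norm_num)
  obtain ⟨n, hn⟩ := ((ENNReal.tendsto_nhds_zero.1 hDlim) _ hκ4).exists
  set H := toMeasurable μ (D n) with hH
  have hHc : μ Hᶜ ≤ κ / 4 := by
    rw [measure_compl (measurableSet_toMeasurable _ _) (measure_ne_top _ _), hμ1,
      measure_toMeasurable]
    exact hn
  filter_upwards [Filter.eventually_ge_atTop (n + 1)] with N hN
  set S := {t | η ≤ ‖stepQuotient Φ N t - f t‖} with hS
  have hmem : ∀ {k M : ℕ}, k + 1 ≤ M → ∀ t ∈ D k, 1 / (M : ℝ) < δ t := fun {k M} hkM t ht =>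
    (one_div_le_one_div_of_le (by positivity) (by exact_mod_cast hkM)).trans_lt ht
  have hSHk : ∀ k, μ (S ∩ H ∩ D k) ≤ κ / 4 + (κ / 4 + κ / 4) := fun k => by
    set M := max k N + 1 with hM
    have hkM : k + 1 ≤ M := by simp [hM]
    have hnM : n + 1 ≤ M := by have := le_max_right k N; omega
    set T := {t | η / 2 ≤ ‖stepQuotient Φ M t - stepQuotient Φ N t‖} with hT
    have hTmeas : MeasurableSet T := measurableSet_le measurable_const
      ((stronglyMeasurable_stepQuotient Φ M).sub
        (stronglyMeasurable_stepQuotient Φ N)).norm.measurable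
    have hsub1 : S ∩ H ∩ D k ⊆ Bad M ∪ (H ∩ T) := by
      rintro t ⟨⟨hSt, hHt⟩, hDt⟩
      by_cases hb : η / 4 ≤ ‖stepQuotient Φ M t - f t‖
      · exact Or.inl ⟨hmem hkM t hDt, hb⟩
      · refine Or.inr ⟨hHt, ?_⟩
        have h1 := norm_sub_le_norm_sub_add_norm_sub (stepQuotient Φ N t) (stepQuotient Φ M t) (f t)
        rw [norm_sub_rev (stepQuotient Φ N t) (stepQuotient Φ M t)] at h1
        simp only [hS, hT, mem_ofPred_eq, not_le] at hSt hb ⊢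
        linarith
    have hsub2 : D n ∩ T ⊆ Bad M ∪ Bad N := by
      rintro t ⟨hDt, hTt⟩
      by_cases hb : η / 4 ≤ ‖stepQuotient Φ M t - f t‖
      · exact Or.inl ⟨hmem hnM t hDt, hb⟩
      · refine Or.inr ⟨hmem hN t hDt, ?_⟩
        have h1 := norm_sub_le_norm_sub_add_norm_sub (stepQuotient Φ M t) (f t) (stepQuotient Φ N t)
        rw [norm_sub_rev (f t) (stepQuotient Φ N t)] at h1
        simp only [hT, mem_ofPred_eq, not_le] at hTt hb
        linarith
    calc μ (S ∩ H ∩ D k) ≤ μ (Bad M) + μ (H ∩ T) :=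
          (measure_mono hsub1).trans (measure_union_le _ _)
      _ = μ (Bad M) + μ (D n ∩ T) := by
          rw [hH, Measure.measure_toMeasurable_inter_of_sFinite hTmeas]
      _ ≤ μ (Bad M) + (μ (Bad M) + μ (Bad N)) := by
          gcongr
          exact (measure_mono hsub2).trans (measure_union_le _ _)
      _ ≤ κ / 4 + (κ / 4 + κ / 4) := by
          gcongr <;> exact hBadle _ (by omega)
  have hSH : μ (S ∩ H) ≤ κ / 4 + (κ / 4 + κ / 4) := by
    calc μ (S ∩ H) ≤ μ (⋃ k, S ∩ H ∩ D k) := by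
          rw [hμ, Measure.restrict_apply' measurableSet_Ico,
            Measure.restrict_apply' measurableSet_Ico, ← inter_iUnion]
          exact measure_mono fun t ht => ⟨⟨ht.1, hDcover ht.2⟩, ht.2⟩
      _ = ⨆ k, μ (S ∩ H ∩ D k) :=
          Monotone.measure_iUnion fun i j hij => inter_subset_inter_right _ (hDmono hij)
      _ ≤ _ := iSup_le hSHk
  calc μ S ≤ μ (S ∩ H) + μ Hᶜ := (measure_mono fun t ht => by
        by_cases hHt : t ∈ H
        · exact Or.inl ⟨ht, hHt⟩
        · exact Or.inr hHt).trans (measure_union_le _ _)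
    _ ≤ κ / 4 + (κ / 4 + κ / 4) + κ / 4 := add_le_add hSH hHc
    _ = κ := by
        rw [ENNReal.div_add_div_same, ENNReal.div_add_div_same, ENNReal.div_add_div_same,
          show κ + (κ + κ) + κ = κ * 4 by ring]
        exact ENNReal.mul_div_cancel_right (by norm_num) (by norm_num)

theorem FvHIntegrable.aestronglyMeasurable {f : ℝ → X} (h : FvHIntegrable f) :
    AEStronglyMeasurable f (volume.restrict (Ico (0 : ℝ) 1)) := by
  obtain ⟨Φ, hΦ⟩ := h
  exact hΦ.tendstoInMeasure_stepQuotient.aestronglyMeasurable fun N =>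
    (stronglyMeasurable_stepQuotient Φ N).aestronglyMeasurable

/-- A variational McShane primitive is a variational Henstock primitive. -/
theorem FvHPrimitive.of_forall_isFine {f : ℝ → X} {Φ : ℝ → ℝ → X} (hadd : AdditiveIntervalF Φ)
    (hΦ : ∀ ε > 0, ∃ δ : ℝ → ℝ, IsGauge δ ∧ ∀ (n : ℕ) (P : TP n), P.IsFine δ →
      ∑ i : Fin n, ‖Φ (P.pt i.castSucc) (P.pt i.succ) - P.len i • f (P.tag i)‖ < ε) :
    FvHPrimitive f Φ := by
  refine ⟨hadd, fun ε hε => ?_⟩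
  obtain ⟨δ, hδ, hsum⟩ := hΦ ε hε
  exact ⟨δ, hδ, fun n P _ hP => hsum n P hP⟩

theorem FvMSIntegrable.fvHIntegrable {f : ℝ → X} (h : FvMSIntegrable f) : FvHIntegrable f := by
  obtain ⟨Φ, hadd, hΦ⟩ := h
  exact ⟨Φ, .of_forall_isFine hadd hΦ⟩

/-- The partition of `[0,1]` into `N` intervals of equal length. -/
noncomputable def TP.uniform {N : ℕ} (hN : 0 < N) (tag : Fin N → ℝ)
    (htag : ∀ i, tag i ∈ Icc (0 : ℝ) 1) : TP N where
  pt i := (i : ℕ) / N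
  tag := tag
  mono i j hij := by
    have : (i : ℕ) ≤ j := hij
    dsimp only
    gcongr
  first := by simp
  last := by
    have : (N : ℝ) ≠ 0 := by exact_mod_cast hN.ne'
    simp [this]
  tagMem := htag

theorem exists_forall_sum_norm_uniform_le {f : ℝ → X} {Φ : ℝ → ℝ → X}
    (h : ∃ δ : ℝ → ℝ, IsGauge δ ∧ ∀ (n : ℕ) (P : TP n), P.IsFine δ →
      ∑ i : Fin n, ‖Φ (P.pt i.castSucc) (P.pt i.succ) - P.len i • f (P.tag i)‖ < 1) :
    ∃ C : ℝ, ∀ᶠ N : ℕ in Filter.atTop,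
      ∑ k ∈ Finset.range N, ‖Φ ((k : ℝ) / N) ((k + 1) / N)‖ ≤ C := by
  obtain ⟨δ, hδ, hsum⟩ := h
  obtain ⟨F, hF⟩ := isCompact_Icc.elim_finite_subcover (s := Icc (0 : ℝ) 1)
    (fun t : Icc (0 : ℝ) 1 => ball (t : ℝ) (δ t)) (fun _ => isOpen_ball)
    fun t ht => mem_iUnion.2 ⟨⟨t, ht⟩, mem_ball_self (hδ t ht)⟩
  obtain ⟨ρ, hρ, hleb⟩ := lebesgue_number_lemma_of_metric (s := Icc (0 : ℝ) 1) isCompact_Icc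
    (c := fun t : F => ball ((t : Icc (0 : ℝ) 1) : ℝ) (δ (t : Icc (0 : ℝ) 1)))
    (fun _ => isOpen_ball) fun x hx => by
      obtain ⟨t, ht, hxt⟩ := mem_iUnion₂.1 (hF hx)
      exact mem_iUnion.2 ⟨⟨t, ht⟩, hxt⟩
  obtain ⟨C, hC⟩ : ∃ C : ℝ, ∀ t ∈ F, ‖f t‖ ≤ C := by
    obtain ⟨C, hC⟩ := (F.finite_toSet.image fun t : Icc (0 : ℝ) 1 => ‖f t‖).bddAbove
    exact ⟨C, fun t ht => hC ⟨t, ht, rfl⟩⟩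
  obtain ⟨N₀, hN₀⟩ := exists_nat_one_div_lt hρ
  refine ⟨1 + C, ?_⟩
  filter_upwards [Filter.eventually_ge_atTop (N₀ + 1)] with N hN
  have hNpos : 0 < N := by omega
  have hN' : (0 : ℝ) < N := by exact_mod_cast hNpos
  have hNρ : 1 / (N : ℝ) < ρ :=
    (one_div_le_one_div_of_le (by positivity) (by exact_mod_cast hN)).trans_lt hN₀
  have hcell : ∀ i : Fin N, ((i : ℕ) : ℝ) / N ∈ Icc (0 : ℝ) 1 := fun i =>
    ⟨by positivity, (div_le_one hN').2 (by exact_mod_cast i.2.le)⟩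
  choose tag htag using fun i : Fin N => hleb _ (hcell i)
  set P := TP.uniform hNpos (fun i => ((tag i : Icc (0:ℝ) 1) : ℝ)) (fun i => (tag i).1.2) with hP
  have hpt : ∀ i, P.pt i = (i : ℕ) / N := fun i => rfl
  have hlen : ∀ i, P.len i = 1 / N := fun i => by
    simp only [TP.len, hpt, Fin.val_succ, Fin.val_castSucc]
    push_cast
    ring
  have hfine : P.IsFine δ := fun i y hy => by
    have hy' : y ∈ ball (((i : ℕ) : ℝ) / N) ρ := by
      obtain ⟨h1, h2⟩ := hy
      simp only [hpt, Fin.val_succ, Fin.val_castSucc] at h1 h2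
      push_cast at h2
      rw [add_div] at h2
      rw [mem_ball, Real.dist_eq, abs_lt]
      constructor <;> linarith
    have := htag i hy'
    rwa [Real.ball_eq_Ioo] at this
  calc ∑ k ∈ Finset.range N, ‖Φ ((k : ℝ) / N) ((k + 1) / N)‖
      = ∑ i : Fin N, ‖Φ (P.pt i.castSucc) (P.pt i.succ)‖ := by
        rw [Finset.sum_range]
        simp [hpt]
    _ ≤ ∑ i : Fin N, (‖Φ (P.pt i.castSucc) (P.pt i.succ) - P.len i • f (P.tag i)‖ + C / N) := by
        refine Finset.sum_le_sum fun i _ => ?_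
        have h1 : ‖P.len i • f (P.tag i)‖ ≤ C / N := by
          rw [hlen, norm_smul, Real.norm_of_nonneg (by positivity), one_div_mul_eq_div]
          gcongr
          exact hC _ (tag i).2
        linarith [norm_sub_norm_le (Φ (P.pt i.castSucc) (P.pt i.succ)) (P.len i • f (P.tag i))]
    _ ≤ 1 + C := by
        rw [Finset.sum_add_distrib, Finset.sum_const, Finset.card_univ, Fintype.card_fin,
          nsmul_eq_mul, mul_div_cancel₀ _ hN'.ne']
        linarith [hsum N P hfine]

theorem lintegral_enorm_stepQuotient_le (Φ : ℝ → ℝ → X) {N : ℕ} (hN : 0 < N) :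
    ∫⁻ t in Ico (0 : ℝ) 1, ‖stepQuotient Φ N t‖ₑ ≤
      ENNReal.ofReal (∑ k ∈ Finset.range N, ‖Φ ((k : ℝ) / N) ((k + 1) / N)‖) := by
  have hN' : (0 : ℝ) < N := by exact_mod_cast hN
  have hcover : Ico (0 : ℝ) 1 ⊆
      ⋃ k : Fin N, Ico (((k : ℕ) : ℝ) / N) (((k : ℕ) + 1) / N) := fun t ht =>
    mem_iUnion.2 ⟨⟨⌊(N : ℝ) * t⌋₊, (Nat.floor_lt (mul_nonneg hN'.le ht.1)).2 (by nlinarith [ht.2])⟩,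
      mem_Ico_of_floor_eq hN ht.1 rfl⟩
  have hcell : ∀ k : ℕ, ∫⁻ t in Ico ((k : ℝ) / N) ((k + 1) / N), ‖stepQuotient Φ N t‖ₑ =
      ENNReal.ofReal ‖Φ ((k : ℝ) / N) ((k + 1) / N)‖ := fun k => by
    have h1 : ∀ t ∈ Ico ((k : ℝ) / N) ((k + 1) / N),
        ‖stepQuotient Φ N t‖ₑ = ‖(N : ℝ) • Φ ((k : ℝ) / N) ((k + 1) / N)‖ₑ := fun t ht => by
      have hfl : ⌊(N : ℝ) * t⌋₊ = k := by
        have ht0 : 0 ≤ t := le_trans (by positivity) ht.1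
        refine (Nat.floor_eq_iff (by positivity)).2 ⟨?_, ?_⟩
        · linarith [(div_le_iff₀ hN').1 ht.1]
        · linarith [(lt_div_iff₀ hN').1 ht.2]
      rw [stepQuotient, hfl]
    rw [setLIntegral_congr_fun measurableSet_Ico h1, setLIntegral_const, volume_Ico_div,
      ← ofReal_norm, ← ENNReal.ofReal_mul (norm_nonneg _), norm_smul,
      Real.norm_of_nonneg hN'.le]
    congr 1
    field_simp
  calc ∫⁻ t in Ico (0 : ℝ) 1, ‖stepQuotient Φ N t‖ₑ
      ≤ ∑' k : Fin N, ∫⁻ t in Ico (((k : ℕ) : ℝ) / N) (((k : ℕ) + 1) / N),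
          ‖stepQuotient Φ N t‖ₑ :=
        (lintegral_mono_set hcover).trans (lintegral_iUnion_le _ _)
    _ = _ := by
        simp_rw [hcell]
        rw [tsum_fintype, ENNReal.ofReal_sum_of_nonneg fun _ _ => norm_nonneg _, Finset.sum_range]

theorem FvMSIntegrable.integrableOn {f : ℝ → X} (h : FvMSIntegrable f) :
    IntegrableOn f (Icc (0 : ℝ) 1) volume := by
  have hmeas := h.fvHIntegrable.aestronglyMeasurable
  rw [integrableOn_Icc_iff_integrableOn_Ico]
  refine ⟨hmeas, ?_⟩
  obtain ⟨Φ, hadd, hΦ⟩ := h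
  have hH : FvHPrimitive f Φ := .of_forall_isFine hadd hΦ
  obtain ⟨ns, hns, hlim⟩ := hH.tendstoInMeasure_stepQuotient.exists_seq_tendsto_ae
  obtain ⟨C, hC⟩ := exists_forall_sum_norm_uniform_le (hΦ 1 one_pos)
  have hbound : ∀ᶠ i in Filter.atTop,
      ∫⁻ t in Ico (0 : ℝ) 1, ‖stepQuotient Φ (ns i) t‖ₑ ≤ ENNReal.ofReal C := by
    filter_upwards [hns.tendsto_atTop.eventually hC,
      hns.tendsto_atTop.eventually (Filter.eventually_gt_atTop 0)] with i hi hpos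
    exact (lintegral_enorm_stepQuotient_le Φ hpos).trans (ENNReal.ofReal_le_ofReal hi)
  calc ∫⁻ t in Ico (0 : ℝ) 1, ‖f t‖ₑ
      ≤ Filter.liminf (fun i => ∫⁻ t in Ico (0 : ℝ) 1, ‖stepQuotient Φ (ns i) t‖ₑ)
          Filter.atTop := by
        refine le_trans (lintegral_mono_ae ?_) (lintegral_liminf_le fun i =>
          (stronglyMeasurable_stepQuotient Φ (ns i)).enorm)
        filter_upwards [hlim] with t ht
        exact ht.enorm.liminf_eq.ge
    _ ≤ ENNReal.ofReal C :=
        (Filter.liminf_le_liminf hbound).trans_eq (Filter.liminf_const _)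
    _ < ⊤ := ENNReal.ofReal_lt_top

/-! ### Bochner integrable functions -/

theorem TP.pt_nonneg {n : ℕ} (P : TP n) (i : Fin (n + 1)) : 0 ≤ P.pt i :=
  P.first ▸ P.mono (Fin.zero_le i)

theorem TP.pt_le_one {n : ℕ} (P : TP n) (i : Fin (n + 1)) : P.pt i ≤ 1 :=
  P.last ▸ P.mono (Fin.le_last i)

theorem TP.pairwise_disjoint_Ioc {n : ℕ} (P : TP n) :
    Pairwise (Function.onFun Disjoint fun i : Fin n => Ioc (P.pt i.castSucc) (P.pt i.succ)) := by
  have key : ∀ i j : Fin n, i < j →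
      Disjoint (Ioc (P.pt i.castSucc) (P.pt i.succ)) (Ioc (P.pt j.castSucc) (P.pt j.succ)) :=
    fun i j hij => Set.disjoint_left.2 fun x hx hx' =>
      absurd (hx.2.trans (P.mono (Fin.succ_le_castSucc_iff.2 hij))) (not_le.2 hx'.1)
  intro i j hij
  rcases lt_or_gt_of_ne hij with h | h
  · exact key i j h
  · exact (key j i h).symm

/-- If the tags are classified by a countable index set, and the class with index `k` is small for
the measure `μ k`, then, over fine partitions, the sum of the `μ k`-measures of the intervals whose
tag has index `k` is small. -/
theorem exists_isGauge_sum_measure_lt {ι : Type*} [Countable ι] (c : ℝ → ι) (μ : ι → Measure ℝ)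
    [∀ k, IsFiniteMeasure (μ k)] {ε : ℝ≥0∞} (h : ∑' k, μ k (c ⁻¹' {k}) < ε) :
    ∃ δ : ℝ → ℝ, IsGauge δ ∧ ∀ (n : ℕ) (P : TP n), P.IsFine δ →
      ∑ i : Fin n, μ (c (P.tag i)) (Ioc (P.pt i.castSucc) (P.pt i.succ)) < ε := by
  classical
  obtain ⟨e, he, hesum⟩ := ENNReal.exists_pos_sum_of_countable' (tsub_pos_of_lt h).ne' ι
  choose U hU hUo hUlt using fun k =>
    (c ⁻¹' {k}).exists_isOpen_lt_add (μ := μ k) (measure_ne_top _ _) (he k).ne'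
  choose δ hδ hδU using fun t => Metric.isOpen_iff.1 (hUo (c t)) t (hU (c t) rfl)
  refine ⟨δ, fun t _ => hδ t, fun n P hP => ?_⟩
  calc ∑ i : Fin n, μ (c (P.tag i)) (Ioc (P.pt i.castSucc) (P.pt i.succ))
      = ∑ i : Fin n, ∑' k, if c (P.tag i) = k then
          μ k (Ioc (P.pt i.castSucc) (P.pt i.succ)) else 0 := by simp
    _ = ∑' k, ∑ i : Fin n, if c (P.tag i) = k then
          μ k (Ioc (P.pt i.castSucc) (P.pt i.succ)) else 0 :=
        (Summable.tsum_finsetSum fun _ _ => ENNReal.summable).symm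
    _ ≤ ∑' k, μ k (U k) := by
        refine ENNReal.tsum_le_tsum fun k => ?_
        rw [← Finset.sum_filter, ← measure_biUnion_finset
          (fun i _ j _ hij => P.pairwise_disjoint_Ioc hij) fun _ _ => measurableSet_Ioc]
        refine measure_mono (iUnion₂_subset fun i hi => ?_)
        obtain rfl := (Finset.mem_filter.1 hi).2
        refine (Ioc_subset_Icc_self.trans (hP i)).trans ?_
        rw [← Real.ball_eq_Ioo]
        exact hδU _
    _ ≤ ∑' k, (μ k (c ⁻¹' {k}) + e k) := ENNReal.tsum_le_tsum fun k => (hUlt k).le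
    _ < ε := by
        rw [ENNReal.tsum_add]
        calc _ < ∑' k, μ k (c ⁻¹' {k}) + (ε - ∑' k, μ k (c ⁻¹' {k})) :=
              ENNReal.add_lt_add_left h.ne_top hesum
          _ = ε := add_tsub_cancel_of_le h.le

theorem exists_isGauge_sum_setLIntegral_lt {E : Type*} [NormedAddCommGroup E] {f : ℝ → E}
    (hf : IntegrableOn f (Icc (0 : ℝ) 1) volume)
    {ε : ℝ≥0∞} (hε : 0 < ε) :
    ∃ δ : ℝ → ℝ, IsGauge δ ∧ ∀ (n : ℕ) (P : TP n), P.IsFine δ →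
      ∑ i : Fin n, ∫⁻ s in Ioc (P.pt i.castSucc) (P.pt i.succ), ‖f s - f (P.tag i)‖ₑ < ε := by
  classical
  set ν := volume.restrict (Icc (0 : ℝ) 1) with hν
  have hν1 : ν univ = 1 := by simp [hν]
  obtain ⟨η, hη, hηε⟩ : ∃ η : ℝ, 0 < η ∧ ENNReal.ofReal (2 * η) < ε := by
    obtain ⟨r, hr0, hr⟩ := ENNReal.lt_iff_exists_nnreal_btwn.1 hε
    refine ⟨r / 2, by have : (0:ℝ) < r := by exact_mod_cast hr0
                      positivity, ?_⟩
    rwa [mul_div_cancel₀ _ two_ne_zero, ENNReal.ofReal_coe_nnreal]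
  obtain ⟨g, hg, hfg⟩ := hf.aestronglyMeasurable
  obtain ⟨x, hx⟩ : ∃ x : ℕ → E, range g ⊆ closure (range x) := by
    obtain ⟨S, hS, hgS⟩ := hg.isSeparable_range
    have hne : S.Nonempty := closure_nonempty_iff.1 ((range_nonempty g).mono hgS)
    obtain ⟨x, rfl⟩ := hS.exists_eq_range hne
    exact ⟨x, hgS⟩
  have hex : ∀ t, ∃ k, ‖g t - x k‖ < η := fun t => by
    obtain ⟨_, ⟨k, rfl⟩, hk⟩ := Metric.mem_closure_iff.1 (hx ⟨t, rfl⟩) η hη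
    exact ⟨k, by rwa [← dist_eq_norm]⟩
  set κ : ℝ → ℕ := fun t => Nat.find (hex t) with hκ
  have hκmeas : Measurable κ := measurable_find hex fun k =>
    measurableSet_lt (hg.sub stronglyMeasurable_const).norm.measurable measurable_const
  have hκspec : ∀ t, ‖g t - x (κ t)‖ < η := fun t => Nat.find_spec (hex t)
  set c : ℝ → ℕ × ℕ := fun t => (κ t, ⌊‖f t - x (κ t)‖ / η⌋₊) with hc
  set μ : ℕ × ℕ → Measure ℝ := fun p =>
    ν.withDensity fun s => ‖f s - x p.1‖ₑ + ENNReal.ofReal ((p.2 + 1) * η) with hμ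
  have hfin : ∀ p, IsFiniteMeasure (μ p) := fun p => by
    refine isFiniteMeasure_withDensity (ne_of_lt ?_)
    rw [lintegral_add_right _ measurable_const, lintegral_const, hν1, mul_one]
    have h1 : Integrable (fun s => f s - x p.1) ν := hf.sub (integrable_const _)
    exact ENNReal.add_lt_top.2 ⟨h1.2, ENNReal.ofReal_lt_top⟩
  have hnull : ∀ k j, μ (k, j + 1) (c ⁻¹' {(k, j + 1)}) = 0 := fun k j => by
    refine withDensity_absolutelyContinuous _ _ (measure_mono_null (fun t ht => ?_) hfg)
    intro (heq : f t = g t)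
    have h1 : ⌊‖f t - x (κ t)‖ / η⌋₊ = j + 1 := congrArg Prod.snd ht
    rw [heq, Nat.floor_eq_zero.2 ((div_lt_one hη).2 (hκspec t))] at h1
    omega
  have hzero : ∀ k, μ (k, 0) (c ⁻¹' {(k, 0)}) ≤ ENNReal.ofReal (2 * η) * ν (κ ⁻¹' {k}) :=
    fun k => by
      have hmeas : MeasurableSet (κ ⁻¹' {k}) := hκmeas (measurableSet_singleton k)
      calc μ (k, 0) (c ⁻¹' {(k, 0)}) ≤ μ (k, 0) (κ ⁻¹' {k}) :=
            measure_mono fun t ht => congrArg Prod.fst ht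
        _ = ∫⁻ s in κ ⁻¹' {k}, ‖f s - x k‖ₑ + ENNReal.ofReal (((0 : ℕ) + 1) * η) ∂ν :=
            withDensity_apply _ hmeas
        _ ≤ ∫⁻ _ in κ ⁻¹' {k}, ENNReal.ofReal (2 * η) ∂ν := by
            refine lintegral_mono_ae ?_
            filter_upwards [ae_restrict_mem hmeas, ae_restrict_of_ae hfg] with s hs hfgs
            have h1 := hκspec s
            rw [show κ s = k from hs, ← hfgs] at h1
            rw [← ofReal_norm, ← ENNReal.ofReal_add (norm_nonneg _) (by positivity)]
            refine ENNReal.ofReal_le_ofReal ?_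
            push_cast
            linarith
        _ = ENNReal.ofReal (2 * η) * ν (κ ⁻¹' {k}) := setLIntegral_const _ _
  have hsum : ∑' p, μ p (c ⁻¹' {p}) < ε := by
    calc ∑' p, μ p (c ⁻¹' {p}) = ∑' k, ∑' j, μ (k, j) (c ⁻¹' {(k, j)}) := ENNReal.tsum_prod'
      _ = ∑' k, μ (k, 0) (c ⁻¹' {(k, 0)}) := tsum_congr fun k =>
          tsum_eq_single 0 fun j hj => by
            obtain ⟨i, rfl⟩ := Nat.exists_eq_succ_of_ne_zero hj
            exact hnull k i
      _ ≤ ∑' k, ENNReal.ofReal (2 * η) * ν (κ ⁻¹' {k}) := ENNReal.tsum_le_tsum hzero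
      _ = ENNReal.ofReal (2 * η) := by
          rw [ENNReal.tsum_mul_left, ← measure_iUnion
            (fun i j hij => Disjoint.preimage _ (disjoint_singleton.2 hij))
            (fun k => hκmeas (measurableSet_singleton k)), ← preimage_iUnion,
            iUnion_of_singleton, preimage_univ, hν1, mul_one]
      _ < ε := hηε
  obtain ⟨δ, hδ, hP⟩ := exists_isGauge_sum_measure_lt c μ hsum
  refine ⟨δ, hδ, fun n P hfine => (Finset.sum_le_sum fun i _ => ?_).trans_lt (hP n P hfine)⟩
  have hsub : Ioc (P.pt i.castSucc) (P.pt i.succ) ⊆ Icc 0 1 := fun s hs =>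
    ⟨(P.pt_nonneg _).trans hs.1.le, hs.2.trans (P.pt_le_one _)⟩
  set t := P.tag i
  rw [hμ, withDensity_apply _ measurableSet_Ioc, hν, Measure.restrict_restrict measurableSet_Ioc,
    inter_eq_left.2 hsub]
  refine lintegral_mono fun s => ?_
  have h1 : ‖f t - x (κ t)‖ₑ ≤ ENNReal.ofReal (((c t).2 + 1) * η) := by
    rw [← ofReal_norm]
    refine ENNReal.ofReal_le_ofReal ((div_le_iff₀ hη).1 (Nat.lt_floor_add_one _).le)
  calc ‖f s - f t‖ₑ = ‖(f s - x (κ t)) - (f t - x (κ t))‖ₑ := by rw [sub_sub_sub_cancel_right]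
    _ ≤ ‖f s - x (κ t)‖ₑ + ‖f t - x (κ t)‖ₑ := enorm_sub_le
    _ ≤ _ := add_le_add le_rfl h1

theorem fvMSIntegrable_of_integrableOn [CompleteSpace X] {f : ℝ → X}
    (hf : IntegrableOn f (Icc (0 : ℝ) 1) volume) : FvMSIntegrable f := by
  have hint : ∀ a b : ℝ, 0 ≤ a → a ≤ b → b ≤ 1 → IntervalIntegrable f volume a b :=
    fun a b ha hab hb => (intervalIntegrable_iff_integrableOn_Ioc_of_le hab).2
      (hf.mono_set fun s hs => ⟨ha.trans hs.1.le, hs.2.trans hb⟩)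
  refine ⟨fun a b => ∫ s in a..b, f s, fun a b c ha hab hbc hc => ?_, fun ε hε => ?_⟩
  · exact (intervalIntegral.integral_add_adjacent_intervals (hint a b ha hab (hbc.trans hc))
      (hint b c (ha.trans hab) hbc hc)).symm
  obtain ⟨δ, hδ, hsum⟩ := exists_isGauge_sum_setLIntegral_lt hf (ENNReal.ofReal_pos.2 hε)
  refine ⟨δ, hδ, fun n P hP => (ENNReal.ofReal_lt_ofReal_iff hε).1 ?_⟩
  rw [ENNReal.ofReal_sum_of_nonneg fun _ _ => norm_nonneg _]
  refine (Finset.sum_le_sum fun i _ => ?_).trans_lt (hsum n P hP)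
  have hle : P.pt i.castSucc ≤ P.pt i.succ := P.mono (Fin.castSucc_lt_succ).le
  rw [ofReal_norm, TP.len, ← intervalIntegral.integral_const, ← intervalIntegral.integral_sub
    (hint _ _ (P.pt_nonneg _) hle (P.pt_le_one _)) intervalIntegrable_const,
    intervalIntegral.integral_of_le hle]
  exact enorm_integral_le_lintegral_enorm _

/-- Corollary of Theorem `t10` of the paper. A function `f : [0,1] → X` is
variationally McShane integrable (equivalently, Bochner integrable) if and only if it is
variationally Henstock integrable and `t ↦ ‖f(t)‖` is Lebesgue integrable. -/
theorem fvMS_iff_fvH_and_integrablyBounded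
    {X : Type*} [NormedAddCommGroup X] [NormedSpace ℝ X] [CompleteSpace X] (f : ℝ → X) :
    (FvMSIntegrable f ↔
      (FvHIntegrable f ∧ IntegrableOn (fun t => ‖f t‖) (Icc (0:ℝ) 1) volume)) ∧
    (FvMSIntegrable f ↔ IntegrableOn f (Icc (0:ℝ) 1) volume) := by
  have hiff : FvMSIntegrable f ↔ IntegrableOn f (Icc (0:ℝ) 1) volume :=
    ⟨FvMSIntegrable.integrableOn, fvMSIntegrable_of_integrableOn⟩
  refine ⟨⟨fun h => ⟨h.fvHIntegrable, h.integrableOn.norm⟩, fun ⟨hH, hnorm⟩ => hiff.2 ?_⟩, hiff⟩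
  rw [integrableOn_Icc_iff_integrableOn_Ico] at hnorm ⊢
  exact (integrable_norm_iff hH.aestronglyMeasurable).1 hnorm

end GaugePaper
end

section
/- Let X be a Banach space. If f : [0,1] → X is strongly measurable, then f is strongly Riemann measurable: for every ε>0 there exist δ>0 and a closed set F ⊆ [0,1] with λ([0,1]∖F) < ε such that Σ_{k=1}^K ‖f(t_k) − f(t'_k)‖ |I_k| < ε whenever {I_1,…,I_K} is a finite family of nonoverlapping subintervals of [0,1] with max_k |I_k| < δ and all points t_k, t'_k are chosen in I_k ∩ F. -/
open Set Metric MeasureTheory Pointwise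
open scoped ENNReal NNReal

namespace GaugePaper

variable (X : Type*) [NormedAddCommGroup X] [NormedSpace ℝ X]

variable {X}

open Filter Topology in
/-- A strongly measurable function is approximated in measure by continuous functions with compact
support. -/
theorem exists_hasCompactSupport_continuous_measure_le {α E : Type*} [TopologicalSpace α]
    [NormalSpace α] [R1Space α] [WeaklyLocallyCompactSpace α] [MeasurableSpace α] [BorelSpace α]
    [NormedAddCommGroup E] [NormedSpace ℝ E] {μ : Measure α} [IsFiniteMeasure μ] [μ.Regular]
    {f : α → E} (hf : AEStronglyMeasurable f μ)
    {η ρ : ℝ≥0∞} (hη : η ≠ 0) (hη' : η ≠ ∞) (hρ : ρ ≠ 0) :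
    ∃ g : α → E, HasCompactSupport g ∧ Continuous g ∧ μ {x | η ≤ ‖f x - g x‖ₑ} ≤ ρ := by
  have hη2 : η / 2 ≠ 0 := (ENNReal.half_pos hη).ne'
  have hρ2 : ρ / 2 ≠ 0 := (ENNReal.half_pos hρ).ne'
  obtain ⟨s, hs⟩ : ∃ s : SimpleFunc α E, μ {x | η / 2 ≤ edist (s x) (f x)} ≤ ρ / 2 := by
    have hlim : TendstoInMeasure μ (fun n x => hf.stronglyMeasurable_mk.approx n x) atTop f := by
      refine tendstoInMeasure_of_tendsto_ae (fun n => SimpleFunc.aestronglyMeasurable _) ?_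
      filter_upwards [hf.ae_eq_mk] with x hx
      rw [hx]
      exact hf.stronglyMeasurable_mk.tendsto_approx x
    obtain ⟨n, hn⟩ := ((hlim _ (pos_iff_ne_zero.2 hη2)).eventually_le_const
      (pos_iff_ne_zero.2 hρ2)).exists
    exact ⟨_, hn⟩
  obtain ⟨g, g_supp, hsg, g_cont, g_int⟩ :=
    (s.integrable_of_isFiniteMeasure (μ := μ)).exists_hasCompactSupport_lintegral_sub_le
      (mul_ne_zero hη2 hρ2)
  refine ⟨g, g_supp, g_cont, ?_⟩
  have hmarkov : μ {x | η / 2 ≤ ‖s x - g x‖ₑ} ≤ ρ / 2 := by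
    have h := (mul_meas_ge_le_lintegral₀
      (s.aestronglyMeasurable.sub g_int.aestronglyMeasurable).enorm (η / 2)).trans hsg
    exact (ENNReal.mul_le_mul_iff_right hη2 (ENNReal.div_ne_top hη' two_ne_zero)).1 h
  have hsub : {x | η ≤ ‖f x - g x‖ₑ} ⊆
      {x | η / 2 ≤ edist (s x) (f x)} ∪ {x | η / 2 ≤ ‖s x - g x‖ₑ} := by
    intro x hx
    by_contra! hcon
    simp only [mem_union, mem_ofPred_eq, not_or, not_le] at hcon hx
    refine absurd hx (not_le.2 ?_)
    calc ‖f x - g x‖ₑ = edist (f x) (g x) := (edist_eq_enorm_sub _ _).symm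
      _ ≤ edist (s x) (f x) + edist (s x) (g x) := edist_triangle_left _ _ _
      _ < η / 2 + η / 2 := ENNReal.add_lt_add hcon.1 (by simpa [edist_eq_enorm_sub] using hcon.2)
      _ = η := ENNReal.add_halves η
  calc μ {x | η ≤ ‖f x - g x‖ₑ} ≤ ρ / 2 + ρ / 2 :=
        (measure_mono hsub).trans ((measure_union_le _ _).trans (add_le_add hs hmarkov))
    _ = ρ := ENNReal.add_halves ρ

/-- The total length of a partial Perron family in `[0,1]` is at most `1`. -/
theorem PTP.sum_length_le_one {n : ℕ} (P : PTP n) : ∑ i, (P.b i - P.a i) ≤ 1 := by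
  have hdisj : Pairwise (Function.onFun (AEDisjoint (volume : Measure ℝ))
      fun i => Icc (P.a i) (P.b i)) :=
    fun i j hij => (P.nonoverlap i j hij).measure_zero volume
  have hvol : ∑ i, volume (Icc (P.a i) (P.b i)) ≤ volume (Icc (0:ℝ) 1) := by
    rw [← tsum_fintype (L := .unconditional _),
      ← measure_iUnion₀ hdisj fun i => measurableSet_Icc.nullMeasurableSet]
    exact measure_mono (iUnion_subset P.sub)
  simp only [Real.volume_Icc] at hvol
  rw [← ENNReal.ofReal_sum_of_nonneg fun i _ => sub_nonneg.2 (P.le i)] at hvol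
  simpa using (ENNReal.ofReal_le_ofReal_iff (by norm_num)).1 hvol

/-- Lemma 5.2 of the paper. Every strongly measurable function
`f : [0,1] → X` is strongly Riemann measurable. -/
theorem stronglyMeasurable_implies_stronglyRiemannMeasurable
    {X : Type*} [NormedAddCommGroup X] [NormedSpace ℝ X] [CompleteSpace X]
    (f : ℝ → X) (hf : AEStronglyMeasurable f (volume.restrict (Icc (0:ℝ) 1))) :
    ∀ ε > 0, ∃ δ > (0:ℝ), ∃ F : Set ℝ, F ⊆ Icc (0:ℝ) 1 ∧ IsClosed F ∧
      volume (Icc (0:ℝ) 1 \ F) < ENNReal.ofReal ε ∧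
      ∀ (n : ℕ) (P : PTP n) (t' : Fin n → ℝ),
        (∀ i, P.b i - P.a i < δ) → (∀ i, P.tag i ∈ F) →
        (∀ i, t' i ∈ Icc (P.a i) (P.b i) ∩ F) →
        ∑ i : Fin n, ‖f (P.tag i) - f (t' i)‖ * (P.b i - P.a i) < ε := by
  intro ε hε
  have hε4 : 0 < ε / 4 := by positivity
  obtain ⟨g, g_supp, g_cont, hg⟩ := exists_hasCompactSupport_continuous_measure_le hf
    (ENNReal.ofReal_pos.2 hε4).ne' ENNReal.ofReal_ne_top (ENNReal.ofReal_pos.2 hε4).ne'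
  obtain ⟨δ, hδ, hgδ⟩ := Metric.uniformContinuous_iff.1
    (g_supp.uniformContinuous_of_continuous g_cont) (ε / 4) hε4
  set B := toMeasurable (volume.restrict (Icc (0:ℝ) 1))
    {x | ENNReal.ofReal (ε / 4) ≤ ‖f x - g x‖ₑ} with hB
  have hBm : MeasurableSet B := measurableSet_toMeasurable _ _
  have hBvol : volume (Icc (0:ℝ) 1 ∩ B) ≤ ENNReal.ofReal (ε / 4) := by
    rwa [inter_comm, ← Measure.restrict_apply hBm, hB, measure_toMeasurable]
  obtain ⟨F, hFs, hFc, hF⟩ := (measurableSet_Icc.diff hBm).exists_isClosed_sdiff_lt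
    (measure_ne_top_of_subset sdiff_subset (measure_Icc_lt_top (μ := volume)).ne)
    (ENNReal.ofReal_pos.2 hε4).ne'
  have hfg : ∀ x ∈ F, dist (f x) (g x) < ε / 4 := by
    intro x hx
    have h : ¬ ENNReal.ofReal (ε / 4) ≤ ‖f x - g x‖ₑ :=
      fun h => (hFs hx).2 (subset_toMeasurable _ _ h)
    rw [not_le, ← ofReal_norm, ENNReal.ofReal_lt_ofReal_iff hε4] at h
    rwa [dist_eq_norm]
  refine ⟨δ, hδ, F, hFs.trans sdiff_subset, hFc, ?_, fun n P t' hlen htag ht' => ?_⟩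
  · have hsub : Icc (0:ℝ) 1 \ F ⊆ Icc (0:ℝ) 1 ∩ B ∪ (Icc (0:ℝ) 1 \ B) \ F := by
      intro x hx
      by_cases hxB : x ∈ B
      · exact Or.inl ⟨hx.1, hxB⟩
      · exact Or.inr ⟨⟨hx.1, hxB⟩, hx.2⟩
    calc volume (Icc (0:ℝ) 1 \ F) ≤ ENNReal.ofReal (ε / 4) + ENNReal.ofReal (ε / 4) :=
          (measure_mono hsub).trans ((measure_union_le _ _).trans (add_le_add hBvol hF.le))
      _ = ENNReal.ofReal (ε / 4 + ε / 4) := (ENNReal.ofReal_add hε4.le hε4.le).symm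
      _ < ENNReal.ofReal ε := (ENNReal.ofReal_lt_ofReal_iff hε).2 (by linarith)
  · have hterm : ∀ i, ‖f (P.tag i) - f (t' i)‖ ≤ 3 * (ε / 4) := by
      intro i
      have hdist : dist (P.tag i) (t' i) < δ :=
        (Real.dist_le_of_mem_Icc (P.perron i) (ht' i).1).trans_lt (hlen i)
      have h₁ := hfg _ (htag i)
      have h₂ := hgδ hdist
      have h₃ := hfg _ (ht' i).2
      rw [dist_comm] at h₃
      rw [← dist_eq_norm]
      linarith [dist_triangle4 (f (P.tag i)) (g (P.tag i)) (g (t' i)) (f (t' i))]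
    calc ∑ i, ‖f (P.tag i) - f (t' i)‖ * (P.b i - P.a i)
        ≤ ∑ i, 3 * (ε / 4) * (P.b i - P.a i) := Finset.sum_le_sum fun i _ =>
          mul_le_mul_of_nonneg_right (hterm i) (sub_nonneg.2 (P.le i))
      _ = 3 * (ε / 4) * ∑ i, (P.b i - P.a i) := (Finset.mul_sum _ _ _).symm
      _ ≤ 3 * (ε / 4) * 1 := mul_le_mul_of_nonneg_left P.sum_length_le_one (by positivity)
      _ < ε := by linarith

end GaugePaper
end

section
/- Let X be a Banach space, f : [0,1] → X any function, δ : [0,1] → ℝ⁺ a gauge, and P = {(t_1,I_1),…,(t_K,I_K)} a δ-fine Perron (Henstock) partition of [0,1] whose tags t_1,…,t_K are all distinct. Then for each ε>0 there exists a δ-fine interior Henstock partition P' = {(t_1,I'_1),…,(t_K,I'_K)} of [0,1] with the same tags such that Σ_{k=1}^K ‖f(t_k)‖ · | |I_k| − |I'_k| | < ε. -/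
open Set Metric MeasureTheory Pointwise
open scoped ENNReal NNReal

namespace GaugePaper

variable (X : Type*) [NormedAddCommGroup X] [NormedSpace ℝ X]

variable {X}

/-- In a Perron partition, the tags increase with the index of the interval. -/
lemma TP.IsPerron.tag_mono {n : ℕ} {P : TP n} (hP : P.IsPerron) : Monotone P.tag := by
  intro i j hij
  rcases hij.eq_or_lt with rfl | hlt
  · exact le_rfl
  · exact (hP i).2.trans ((P.mono (Fin.succ_le_castSucc_iff.2 hlt)).trans (hP j).1)

/-- If the tags of a Perron partition are distinct, there are points that agree with the division
points at both ends and strictly separate consecutive tags elsewhere. -/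
lemma TP.IsPerron.exists_separating {n : ℕ} {P : TP n} (hP : P.IsPerron)
    (htags : Function.Injective P.tag) :
    ∃ m : Fin (n + 1) → ℝ, m 0 = P.pt 0 ∧ m (Fin.last n) = P.pt (Fin.last n) ∧
      (∀ i : Fin n, i.castSucc ≠ 0 → m i.castSucc < P.tag i) ∧
      ∀ i : Fin n, i.succ ≠ Fin.last n → P.tag i < m i.succ := by
  have hmono : StrictMono P.tag := hP.tag_mono.strictMono_of_injective htags
  have key : ∀ j : Fin (n + 1), ∃ x : ℝ, (j = 0 ∨ j = Fin.last n → x = P.pt j) ∧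
      (j ≠ 0 → ∀ i : Fin n, i.castSucc = j → x < P.tag i) ∧
      (j ≠ Fin.last n → ∀ i : Fin n, i.succ = j → P.tag i < x) := by
    intro j
    by_cases h0 : j = 0
    · exact ⟨P.pt j, fun _ => rfl, fun h => absurd h0 h,
        fun _ i hi => absurd (hi.trans h0) (Fin.succ_ne_zero i)⟩
    by_cases h1 : j = Fin.last n
    · exact ⟨P.pt j, fun _ => rfl,
        fun _ i hi => absurd (hi.trans h1) (Fin.castSucc_lt_last i).ne,
        fun h => absurd h1 h⟩
    obtain ⟨a, ha⟩ := Fin.exists_succ_eq.2 h0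
    obtain ⟨b, hb⟩ := Fin.exists_castSucc_eq.2 h1
    have hab : P.tag a < P.tag b := by
      apply hmono
      rw [← Fin.succ_le_castSucc_iff, ha, hb]
    refine ⟨(P.tag a + P.tag b) / 2, fun h => (h.elim h0 h1).elim, fun _ i hi => ?_,
      fun _ i hi => ?_⟩
    · obtain rfl : i = b := Fin.castSucc_injective n (hi.trans hb.symm)
      linarith
    · obtain rfl : i = a := Fin.succ_injective n (hi.trans ha.symm)
      linarith
  choose m hend hleft hright using key
  exact ⟨m, hend 0 (Or.inl rfl), hend _ (Or.inr rfl), fun i hi => hleft _ hi i rfl,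
    fun i hi => hright _ hi i rfl⟩

/-- Lemma `ex3nara` of the paper. Given a gauge `δ`, a `δ`-fine Perron
partition of `[0,1]` with pairwise distinct tags, and `ε > 0`, there is a `δ`-fine *interior*
Henstock partition of `[0,1]` with the same tags such that
`∑_k ‖f(t_k)‖ · ||I_k| - |I'_k|| < ε`. -/
theorem interior_partition_exists
    {X : Type*} [NormedAddCommGroup X] [NormedSpace ℝ X] [CompleteSpace X]
    (f : ℝ → X) (δ : ℝ → ℝ) (hδ : IsGauge δ) {n : ℕ} (P : TP n)
    (hPerron : P.IsPerron) (hfine : P.IsFine δ) (htags : Function.Injective P.tag) :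
    ∀ ε > 0, ∃ P' : TP n, P'.tag = P.tag ∧ P'.IsFine δ ∧ P'.IsInterior ∧
      ∑ i : Fin n, ‖f (P.tag i)‖ * |P.len i - P'.len i| < ε := by
  intro ε hε
  obtain ⟨m, hm0, hm1, hml, hmr⟩ := hPerron.exists_separating htags
  -- Move the division points slightly towards the separating points.
  let q : ℝ → Fin (n + 1) → ℝ := fun s j => P.pt j + s * (m j - P.pt j)
  have hq : ∀ j, Continuous fun s => q s j := fun j => by fun_prop
  have hq_zero : ∀ j, q 0 j = P.pt j := fun j => by simp [q]
  have hq_first : ∀ s, q s 0 = 0 := fun s => by simp [q, hm0, P.first]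
  have hq_last : ∀ s, q s (Fin.last n) = 1 := fun s => by simp [q, hm1, P.last]
  have hfine_ev : ∀ᶠ s in nhds (0 : ℝ), ∀ i : Fin n,
      P.tag i - δ (P.tag i) < q s i.castSucc ∧ q s i.succ < P.tag i + δ (P.tag i) := by
    refine Filter.eventually_all.2 fun i => ?_
    have hle : P.pt i.castSucc ≤ P.pt i.succ := (hPerron i).1.trans (hPerron i).2
    refine ((hq _).continuousAt.eventually_const_lt ?_).and
      ((hq _).continuousAt.eventually_lt_const ?_)
    · simpa only [hq_zero] using (hfine i (left_mem_Icc.2 hle)).1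
    · simpa only [hq_zero] using (hfine i (right_mem_Icc.2 hle)).2
  have hsum_ev : ∀ᶠ s in nhds (0 : ℝ),
      ∑ i : Fin n, ‖f (P.tag i)‖ * |P.len i - (q s i.succ - q s i.castSucc)| < ε := by
    have hc : Continuous fun s =>
        ∑ i : Fin n, ‖f (P.tag i)‖ * |P.len i - (q s i.succ - q s i.castSucc)| := by
      fun_prop
    refine hc.continuousAt.eventually_lt_const ?_
    simpa [hq_zero, TP.len] using hε
  obtain ⟨s, ⟨hsfine, hssum⟩, hs0, hs1⟩ :=
    (((hfine_ev.and hsum_ev).filter_mono nhdsWithin_le_nhds).and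
      (Ioo_mem_nhdsGT (zero_lt_one (α := ℝ)))).exists
  have hleft : ∀ i : Fin n, i.castSucc ≠ 0 → q s i.castSucc < P.tag i := fun i hi => by
    have h1 := hml i hi
    have h2 := (hPerron i).1
    simp only [q]
    nlinarith
  have hright : ∀ i : Fin n, i.succ ≠ Fin.last n → P.tag i < q s i.succ := fun i hi => by
    have h1 := hmr i hi
    have h2 := (hPerron i).2
    simp only [q]
    nlinarith
  have hleft' : ∀ i : Fin n, q s i.castSucc ≤ P.tag i := fun i => by
    by_cases hi : i.castSucc = 0
    · rw [hi, hq_first]; exact (P.tagMem i).1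
    · exact (hleft i hi).le
  have hright' : ∀ i : Fin n, P.tag i ≤ q s i.succ := fun i => by
    by_cases hi : i.succ = Fin.last n
    · rw [hi, hq_last]; exact (P.tagMem i).2
    · exact (hright i hi).le
  refine ⟨⟨q s, P.tag, Fin.monotone_iff_le_succ.2 fun i => (hleft' i).trans (hright' i),
    hq_first s, hq_last s, P.tagMem⟩, rfl, fun i => Icc_subset_Ioo (hsfine i).1 (hsfine i).2,
    fun i => ?_, hssum⟩
  have hmem : P.tag i ∈ Icc (q s i.castSucc) (q s i.succ) := ⟨hleft' i, hright' i⟩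
  rcases (hleft' i).eq_or_lt with hl | hl
  · have hi : i.castSucc = 0 := by_contra fun h => (hleft i h).ne hl
    have ht : P.tag i = 0 := by rw [← hl, hi, hq_first]
    exact Or.inr ⟨Or.inl (ht ▸ hmem), hmem, Or.inl ht⟩
  rcases (hright' i).eq_or_lt with hr | hr
  · have hi : i.succ = Fin.last n := by_contra fun h => (hright i h).ne hr
    have ht : P.tag i = 1 := by rw [hr, hi, hq_last]
    exact Or.inr ⟨Or.inr (ht ▸ hmem), hmem, Or.inr ht⟩
  · exact Or.inl ⟨hl, hr⟩

end GaugePaper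
end
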